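/- Let H be a connected 3-graph on n ≥ 9 vertices that is 𝒫₄-free, contains no three pairwise disjoint edges, contains a copy of the minimal 4-cycle C₄, and is not isomorphic to a sub-3-graph of SPₙ. Then |H| ≤ 4n − 10, with equality if and only if H is isomorphic to SKₙ. -/

import Mathlib

open Finset

/-- `H` is a 3-graph on the vertex set `V`: every edge is a 3-element subset of `V`. -/
def ThreeGraphOn (V : Finset ℕ) (H : Finset (Finset ℕ)) : Prop :=
  ∀ e ∈ H, e ⊆ V ∧ e.card = 3

/-- Four edges form a 3-uniform minimal 4-path: `aᵢ ∩ aⱼ ≠ ∅ ↔ |i - j| ≤ 1`. -/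
def IsMinPath4 (a₀ a₁ a₂ a₃ : Finset ℕ) : Prop :=
  (a₀ ∩ a₁).Nonempty ∧ (a₁ ∩ a₂).Nonempty ∧ (a₂ ∩ a₃).Nonempty ∧
    a₀ ∩ a₂ = ∅ ∧ a₀ ∩ a₃ = ∅ ∧ a₁ ∩ a₃ = ∅

/-- `H` contains no minimal 4-path. -/
def P4Free (H : Finset (Finset ℕ)) : Prop :=
  ¬∃ a₀ ∈ H, ∃ a₁ ∈ H, ∃ a₂ ∈ H, ∃ a₃ ∈ H, IsMinPath4 a₀ a₁ a₂ a₃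

/-- `H` is connected on `V`: every partition of `V` into two nonempty parts
is crossed by an edge of `H`. -/
def ConnectedHG (V : Finset ℕ) (H : Finset (Finset ℕ)) : Prop :=
  ∀ U W : Finset ℕ, U ∪ W = V → Disjoint U W → U.Nonempty → W.Nonempty →
    ∃ e ∈ H, (e ∩ U).Nonempty ∧ (e ∩ W).Nonempty

/-- `H` contains three pairwise disjoint edges. -/
def HasM3 (H : Finset (Finset ℕ)) : Prop :=
  ∃ e₁ ∈ H, ∃ e₂ ∈ H, ∃ e₃ ∈ H, e₁ ∩ e₂ = ∅ ∧ e₁ ∩ e₃ = ∅ ∧ e₂ ∩ e₃ = ∅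

/-- `H` contains a copy of the minimal 4-cycle `C₄`: six distinct vertices
with edges `{x₁,y₁,y₂}`, `{y₁,y₂,x₂}`, `{x₂,z₁,z₂}`, `{z₁,z₂,x₁}`. -/
def HasC4 (H : Finset (Finset ℕ)) : Prop :=
  ∃ x₁ x₂ y₁ y₂ z₁ z₂ : ℕ, ({x₁, x₂, y₁, y₂, z₁, z₂} : Finset ℕ).card = 6 ∧
    ({x₁, y₁, y₂} : Finset ℕ) ∈ H ∧ ({y₁, y₂, x₂} : Finset ℕ) ∈ H ∧
    ({x₂, z₁, z₂} : Finset ℕ) ∈ H ∧ ({z₁, z₂, x₁} : Finset ℕ) ∈ H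

/-- `H` is the `P`-star `SPₙ` on `V`: a minimal 2-path `f₁, f₂` (two 3-edges
sharing exactly one vertex) together with all triples of `V` containing a
vertex `v` outside the path and at least one vertex of the path. -/
def IsSPOn (V : Finset ℕ) (H : Finset (Finset ℕ)) : Prop :=
  ∃ v ∈ V, ∃ f₁ f₂ : Finset ℕ, f₁ ⊆ V ∧ f₂ ⊆ V ∧ f₁.card = 3 ∧ f₂.card = 3 ∧
    (f₁ ∩ f₂).card = 1 ∧ v ∉ f₁ ∪ f₂ ∧
    H = {f₁, f₂} ∪
      (V.powersetCard 3).filter (fun t => v ∈ t ∧ (t ∩ (f₁ ∪ f₂)).Nonempty)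

/-- `H` is (isomorphic to) a sub-3-graph of `SPₙ` on `V`. -/
def SubSP (V : Finset ℕ) (H : Finset (Finset ℕ)) : Prop :=
  ∃ H' : Finset (Finset ℕ), IsSPOn V H' ∧ H ⊆ H'

/-- `H` is the `K`-star `SKₙ` on `V`: a complete 3-graph on a 4-set `A`
together with all triples of `V` containing a vertex `v ∉ A` and at least one
vertex of `A`. -/
def IsSKOn (V : Finset ℕ) (H : Finset (Finset ℕ)) : Prop :=
  ∃ v ∈ V, ∃ A : Finset ℕ, A ⊆ V ∧ A.card = 4 ∧ v ∉ A ∧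
    H = A.powersetCard 3 ∪
      (V.powersetCard 3).filter (fun t => v ∈ t ∧ (t ∩ A).Nonempty)

namespace C42

/-! ### A small verified branch-and-bound checker -/

inductive Tr : Type
  | L : List ℕ → Tr
  | P : Tr
  | N : ℕ → Tr → Tr → Tr

def disj (a b : ℕ) : Bool := Nat.beq (Nat.land a b) 0

def pathB (a b c d : ℕ) : Bool :=
  (!disj a b && !disj b c && !disj c d && disj a c && disj a d && disj b d) ||
    (disj a b && disj a c && disj b c)

def pok (q : ℕ) : Bool :=
  pathB (q % 512) (q / 512 % 512) (q / 262144 % 512) (q / 134217728 % 512)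

def cm (q : ℕ) : ℕ :=
  (1 <<< (q % 512)) ||| (1 <<< (q / 512 % 512)) ||| (1 <<< (q / 262144 % 512)) |||
    (1 <<< (q / 134217728 % 512))

/-- `c` with the bits of `b` removed. -/
def rem (c b : ℕ) : ℕ := Nat.xor (Nat.lor c b) b

def pk (K inc exc : ℕ) : List ℕ → ℕ → ℕ → Bool
  | [], _, _ => false
  | q :: l, used, s =>
    pok q && disj (cm q) exc &&
      (Nat.beq (rem (cm q) inc) 0 ||
        (disj (rem (cm q) inc) used && Nat.beq (rem (rem (cm q) inc) K) 0 &&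
          (Nat.beq s 0 || pk K inc exc l (Nat.lor used (rem (cm q) inc)) (s - 1))))

def run (pos : List ℕ) (K : ℕ) : Tr → ℕ → ℕ → ℕ → Bool
  | .L l, inc, exc, s => pk K inc exc l 0 s
  | .P, _, exc, _ => pos.any (fun p => Nat.beq (rem p exc) 0)
  | .N e a b, inc, exc, s =>
    run pos K a (Nat.lor inc (1 <<< e)) exc s &&
      (cond (K.testBit e && !exc.testBit e)
        (Nat.beq s 0 || run pos K b inc (Nat.lor exc (1 <<< e)) (s - 1))
        (run pos K b inc (Nat.lor exc (1 <<< e)) s))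

theorem testBit_rem (c b i : ℕ) : (rem c b).testBit i = (c.testBit i && !b.testBit i) := by
  have : rem c b = (c ||| b) ^^^ b := rfl
  rw [this, Nat.testBit_xor, Nat.testBit_lor]
  cases c.testBit i <;> cases b.testBit i <;> rfl

theorem testBit_lor' (c b i : ℕ) : (Nat.lor c b).testBit i = (c.testBit i || b.testBit i) :=
  Nat.testBit_lor c b i

theorem disj_iff {a b : ℕ} : disj a b = true ↔ a &&& b = 0 := by
  unfold disj
  exact Iff.of_eq Nat.beq_eq

theorem disj_testBit {a b : ℕ} (h : disj a b = true) (i : ℕ) (ha : a.testBit i = true) :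
    b.testBit i = false := by
  have h1 := congrArg (fun n => n.testBit i) (disj_iff.1 h)
  simp only [Nat.testBit_land, ha, Nat.zero_testBit, Bool.true_and] at h1
  exact h1

theorem testBit_one_shl (e i : ℕ) : (1 <<< e).testBit i = true ↔ i = e := by
  rw [Nat.one_shiftLeft, Nat.testBit_two_pow]
  simp [eq_comm]

theorem rem_zero {c b i : ℕ} (h : Nat.beq (rem c b) 0 = true) (hc : c.testBit i = true) :
    b.testBit i = true := by
  have h0 : rem c b = 0 := Nat.eq_of_beq_eq_true h
  have h1 := testBit_rem c b i
  rw [h0, hc] at h1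
  simpa using h1

theorem pk_sound (F : Finset ℕ) (K inc exc : ℕ)
    (hF : ∀ q, pok q = true → ∃ i ∈ F, (cm q).testBit i = true)
    (hinc : ∀ i, inc.testBit i = true → i ∉ F) :
    ∀ (l : List ℕ) (used s : ℕ), pk K inc exc l used s = true →
      (F.filter (fun i => K.testBit i = true ∧ exc.testBit i = false ∧
        used.testBit i = false)).card ≤ s → False := by
  intro l
  induction l with
  | nil => intro used s h; simp [pk] at h
  | cons q l ih =>
    intro used s h hs
    rw [pk, Bool.and_eq_true, Bool.and_eq_true] at h
    obtain ⟨⟨hq, hex⟩, h⟩ := h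
    obtain ⟨i, hi, hci⟩ := hF q hq
    have hni : inc.testBit i = false := by
      by_contra hc
      exact hinc i (by simpa using hc) hi
    have hr : (rem (cm q) inc).testBit i = true := by
      rw [testBit_rem, hci, hni]; rfl
    have hexi := disj_testBit hex i hci
    rw [Bool.or_eq_true] at h
    rcases h with h | h
    · have := rem_zero h hci
      rw [hni] at this; cases this
    · rw [Bool.and_eq_true, Bool.and_eq_true, Bool.or_eq_true] at h
      obtain ⟨⟨hu, hK⟩, h⟩ := h
      have hui := disj_testBit hu i hr
      have hKi := rem_zero hK hr
      have hmem : i ∈ F.filter (fun i => K.testBit i = true ∧ exc.testBit i = false ∧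
        used.testBit i = false) := Finset.mem_filter.2 ⟨hi, hKi, hexi, hui⟩
      have hpos := Finset.card_pos.2 ⟨i, hmem⟩
      rcases h with h | h
      · have := Nat.eq_of_beq_eq_true h
        omega
      · refine ih _ _ h ?_
        have hlt : (F.filter (fun i => K.testBit i = true ∧ exc.testBit i = false ∧
            (Nat.lor used (rem (cm q) inc)).testBit i = false)).card <
            (F.filter (fun i => K.testBit i = true ∧ exc.testBit i = false ∧
              used.testBit i = false)).card := by
          apply Finset.card_lt_card
          refine ⟨?_, ?_⟩
          · intro j hj
            rw [Finset.mem_filter, testBit_lor'] at hj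
            rw [Finset.mem_filter]
            simp at hj
            tauto
          · intro hsub
            have := hsub hmem
            rw [Finset.mem_filter, testBit_lor', hr] at this
            simp at this
        omega

theorem run_sound (F : Finset ℕ) (pos : List ℕ) (K : ℕ)
    (hF : ∀ q, pok q = true → ∃ i ∈ F, (cm q).testBit i = true)
    (hpos : ∀ p ∈ pos, ∃ i, i ∉ F ∧ p.testBit i = true) :
    ∀ (t : Tr) (inc exc s : ℕ), (∀ i, inc.testBit i = true → i ∉ F) →
      (∀ i, exc.testBit i = true → i ∈ F) →
      run pos K t inc exc s = true →
      (F.filter (fun i => K.testBit i = true ∧ exc.testBit i = false)).card ≤ s → False := by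
  intro t
  induction t with
  | L l =>
    intro inc exc s hinc hexc h hs
    refine pk_sound F K inc exc hF hinc l 0 s h ?_
    simpa using hs
  | P =>
    intro inc exc s hinc hexc h hs
    rw [run, List.any_eq_true] at h
    obtain ⟨p, hp, h⟩ := h
    obtain ⟨i, hi, hpi⟩ := hpos p hp
    exact hi (hexc i (rem_zero h hpi))
  | N e a b iha ihb =>
    intro inc exc s hinc hexc h hs
    rw [run, Bool.and_eq_true] at h
    obtain ⟨h1, h2⟩ := h
    by_cases he : e ∈ F
    · have hexc' : ∀ i, (Nat.lor exc (1 <<< e)).testBit i = true → i ∈ F := by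
        intro i hi
        rw [testBit_lor', Bool.or_eq_true, testBit_one_shl] at hi
        rcases hi with hi | hi
        · exact hexc i hi
        · rw [hi]; exact he
      have hsub : F.filter (fun i => K.testBit i = true ∧
          (Nat.lor exc (1 <<< e)).testBit i = false) ⊆
          F.filter (fun i => K.testBit i = true ∧ exc.testBit i = false) := by
        intro j hj
        rw [Finset.mem_filter, testBit_lor'] at hj
        rw [Finset.mem_filter]
        simp at hj
        tauto
      by_cases hc : (K.testBit e && !exc.testBit e) = true
      · rw [hc, cond_true, Bool.or_eq_true] at h2
        have hmem : e ∈ F.filter (fun i => K.testBit i = true ∧ exc.testBit i = false) := by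
          rw [Finset.mem_filter]
          simp at hc
          exact ⟨he, hc⟩
        have hp := Finset.card_pos.2 ⟨e, hmem⟩
        rcases h2 with h2 | h2
        · have := Nat.eq_of_beq_eq_true h2
          omega
        · refine ihb _ _ _ hinc hexc' h2 ?_
          have hlt := Finset.card_lt_card (s := F.filter (fun i => K.testBit i = true ∧
            (Nat.lor exc (1 <<< e)).testBit i = false)) ⟨hsub, fun hh => by
              have := hh hmem
              rw [Finset.mem_filter, testBit_lor', (testBit_one_shl e e).2 rfl] at this
              simp at this⟩
          omega
      · have hc' : (K.testBit e && !exc.testBit e) = false := by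
          cases hx : (K.testBit e && !exc.testBit e)
          · rfl
          · exact absurd hx hc
        rw [hc', cond_false] at h2
        exact ihb _ _ _ hinc hexc' h2 (le_trans (Finset.card_le_card hsub) hs)
    · refine iha _ _ _ ?_ hexc h1 hs
      intro i hi
      rw [testBit_lor', Bool.or_eq_true, testBit_one_shl] at hi
      rcases hi with hi | hi
      · exact hinc i hi
      · rw [hi]; exact he

def inc0 : ℕ := 1688849860288512

def KU : ℕ := 78274679833913472

def K6 : ℕ := 5214322623900981491255210103799808

def K7 : ℕ := 96187274960855069506829049953745047200108665506889728

def K8 : ℕ := 32730833591354881642057235928087634381546317630011676090851571809966766539093633503978323968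

def pg0 : ℕ := 32729838929641044115000418257159233409178763886344064015229022483317739496744726492186935296

def pg1 : ℕ := 32728844267928132924657499115794221004595092370978425752230690276111089940870745158030721024

def qg0 : ℕ := 96184351912791081442605202434324314102675830686613504

def qg1 : ℕ := 96181428864729815632102399798710454008214033971281920

def ps2 : ℕ := 96163890577813184781636465593313779679759698438916096

def ps3 : ℕ := 95813124832184913825532860828330043357173993479078016

def ps4 : ℕ := 96187268761247904320530138894634971042277102312226816

def ps5 : ℕ := 95780977505677078500760722764971936526048521521463296

def exD : ℕ := 96184351912791081442605202434324314026092371571113984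

def poD : ℕ := 32729838929641044115000418257159233409082579534431272933786417280883415182642050661500321792

def poE : ℕ := 726838724295606890549323807888004534353641360687318060281490199180666248473186247578724725519939230290425516260049139727971672670601216

def tB : Tr :=
(.N 76 (.L [10204242993])
(.N 112 (.L [15045499917])
(.N 140 (.L [18794177585])
(.N 176 (.L [23635434509])
(.N 268 (.L [35974046769])
(.N 304 (.L [40815303693])
(.N 84 (.N 137 (.L [6732913289])
(.N 138 (.L [18525759537])
(.N 161 (.L [1901093537])
(.N 162 (.L [21756422157])
(.N 265 (.L [6732913417])
(.N 266 (.L [35705628721])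
(.N 289 (.L [1901093665])
(.N 290 (.L [38936291341])
(.N 168 (.L [6754933317,9398997041,1923113553,11019046925,6754933509,35168800817,1923113745,36788850701,22592661763,6749227533,1914249777,6736613901,1898496561,22575884564,39772563540,11297443971,22588467267])
(.N 296 (.L [6788487749,9399062577,1956667985,11019112461,6788487813,17988997169,1956668049,19609047053,39806085251,6782847501,1947869745,6736613901,1898496561,39755753620,39800842307,11297509635])
(.N 104 (.L [6738156165,17988898865,1906336401,19608948749,6738156293,35168768049,1906336529,36788817933,6732417549,1897439793,6736613901,1898496561,13986048131,13985982723,20441090115])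
(.N 73 (.L [6732419597,17998307913,35178177097,6736613901,6749690441,6783244873,6753884745,6787439177,1897439793,6749227533,6782847501,1898496561,1905287825,6750739013])
(.N 97 (.L [1897447985,19608945165,36788814349,1898496561,1917870689,1951425121,1918919265,1952473697,6732417549,1914249777,1947869745,6733961861,1922064977])
(.N 41 (.L [9398932017,11018981901,17988866609,19608916493,35168735793,36788785677,6736611853,1898488369,6733961861,1905287825,6750739205,1922065169])
(.N 74 (.L [1898488369,9945244293,9945244421,9935857713,9935923249,9935865905,9935931441,6732417549,1914249777,1947869745,19608946701,9398988849])
(.L [36788815885,6784293509,13166585869,9398988849,19609045005,6733961989,1922064977,1914249777,6732417549,1947869745,11313153795]))))))))))))))))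
(.N 148 (.N 73 (.L [6749690441])
(.N 74 (.L [9935857713])
(.N 97 (.L [1917870689])
(.N 98 (.L [13166520333])
(.N 265 (.L [6749690633])
(.N 266 (.L [35705661489])
(.N 289 (.L [1917870881])
(.N 290 (.L [38936324109])
(.N 104 (.L [6738156165,17988898865,1906336401,19608948749,6738156293,35168768049,1906336529,36788817933,13985982723,6732417549,1897439793,6753423885,1915306545,14002759956,39806117955,14032119939])
(.N 296 (.L [6788487813,17988997169,1956668049,19609047053,6788487749,9399062577,1956667985,11019112461,39806117955,6782847501,1947869745,6753423885,1915306545,39800875139,19904221443])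
(.N 168 (.L [6754933317,9398997041,1923113553,11019046925,6754933509,35168800817,1923113745,36788850701,6749227533,1914249777,6753423885,1915306545,22587517187,20441090115])
(.N 292 (.L [1955619409,11019110413,1955619473,19609045005,6787439241,18525866033,6782847501,1947869745,6753421837,1914257969,6750739013,9399054385,11834378371])
(.N 100 (.L [1905287825,19608946701,1905287953,36788815885,6737107593,18525767729,6732417549,1897439793,6753421837,1914257969,6750739205,35168759857])
(.L [1915298353,6782847501,17988890673,21756522509,6750739013,1922065169,6749227533,11019043341,1897439793,35178177161,37082957379]))))))))))))))
(.N 276 (.N 73 (.L [6783244873])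
(.N 74 (.L [9935923249])
(.N 97 (.L [1951425121])
(.N 98 (.L [13166585869])
(.N 137 (.L [6783244937])
(.N 138 (.L [18525857841])
(.N 161 (.L [1951425185])
(.N 162 (.L [21756520461])
(.N 104 (.L [6738156165,17988898865,1906336401,19608948749,6738156293,35168768049,1906336529,36788817933,13986048131,6732417549,1897439793,6787043853,1948926513,37121740867,13981853955])
(.N 168 (.L [6754933509,35168800817,1923113745,36788850701,6754933317,9398997041,1923113553,11019046925,22592759875,6749227533,1914249777,6787043853,1948926513,37121773699])
(.N 296 (.L [6788487749,9399062577,1956667985,11019112461,6788487813,17988997169,1956668049,19609047053,6782847501,1947869745,6787043853,1948926513,11834312963])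
(.N 100 (.L [1905287825,19608946701,1905287953,36788815885,6737107721,35705636913,6732417549,1897439793,6787041805,1947877937,6784293509,17988890673])
(.N 164 (.L [1922065169,36788848653,1922064977,11019044877,6753884937,35705669681,6749227533,1914249777,6787041805,1947877937,6784293445])
(.L [6782847501,1947869745,6732417549,1897439793,6749227533,1914249777,6787043853,1948926513,20473579075,11834378371]))))))))))))))
(.N 69 (.N 26 (.L [6717708869])
(.N 42 (.L [6721903173])
(.N 56 (.L [6725573189])
(.N 82 (.L [6732417549])
(.N 98 (.L [6736611853])
(.N 138 (.L [18535178821])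
(.N 152 (.L [6750739013])
(.N 168 (.L [6754933317])
(.N 266 (.L [35715048005])
(.N 280 (.L [6784293445])
(.N 296 (.L [6788487749])
(.N 146 (.L [19609043469,19608945165,6749227533,6749229581,19608946701,19608948749,19609045005,1914257969,1897439793,35178177097,38936322573,21756518925,9945244421,6782849549])
(.N 274 (.L [36788814349,36788847117,6782847501,6782849549,36788815885,36788817933,36788848653,1947877937,9408373385,6753421837,17998307913,38936322573,1898488369])
(.N 88 (.L [1902142113,1902142241,6733961861,6733961989,21756424205,38936293389,17988890673,35168759857,1897447985,1898488369,6737107593,1906336401])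
(.N 74 (.L [1898496561,9945244293,9945244421,1898488369,9935865905,9935931441,1914257969,1947877937,9408373385,38936322573,21756518925])
(.N 137 (.N 22 (.L [6716660361])
(.N 38 (.L [6720854665])
(.N 52 (.L [6724524681])
(.N 70 (.L [9408373385])
(.N 100 (.L [6737107593])
(.N 162 (.L [6753423885])
(.N 262 (.L [35178177161])
(.N 292 (.L [6787439241])
(.N 134 (.L [1914257969,17998307913,1914249777,17998308105,17988898865])
(.N 290 (.L [38936289805,38936322573,6787041805,6787043853])
(.N 164 (.L [6753884745,1922064977,6753884937])
(.N 104 (.L [6738156165,1906336401])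
(.N 28 (.L [1886413409])
(.N 44 (.L [1890607697])
.P))))))))))))))
(.L [1897447985,6753421837,1947877937,1914257969,6787041805,1905287825,6787439177,1922064977,1906336529])))))))))))))))))
(.N 133 (.N 26 (.L [6717708933])
(.N 42 (.L [6721903237])
(.N 56 (.L [6725573253])
(.N 74 (.L [9945244293])
(.N 88 (.L [6733961861])
(.N 104 (.L [6738156165])
(.N 146 (.L [6749227533])
(.N 162 (.L [6753421837])
(.N 266 (.L [35715048069])
(.N 280 (.L [6784293509])
(.N 296 (.L [6788487813])
(.N 274 (.L [36788814349,36788847117,6782847501,6782849549,36788848653,36788850701,36788815885,11019108877,13166584333,9408373385,17998307913,38936289805,1915298353])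
(.N 73 (.L [6736613901,17998307913,6732419597,35178177097,6753884745,6787439177,1897447985,1915306545,6787041805,1923113553,1918919457,6737107593])
(.N 152 (.L [1918919265,13166522381,1918919457,6750739205,35168792625,38936326157,9398988849,1914257969,1915298353,1922064977,11019046925])
(.L [1947877937,1914257969,1897447985,6787041805,13166584333,1915298353,11019044877,6787439241,1923113553,6737107721])))))))))))))))
(.N 261 (.N 26 (.L [6717709061])
(.N 42 (.L [6721903365])
(.N 56 (.L [6725573381])
(.N 74 (.L [9945244421])
(.N 88 (.L [6733961989])
(.N 104 (.L [6738156293])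
(.N 138 (.L [18535179013])
(.N 152 (.L [6750739205])
(.N 168 (.L [6754933509])
(.N 274 (.L [6782847501])
(.N 290 (.L [6787041805])
(.N 73 (.L [6736613901,35178177097,6732419597,17998307913,6787439177,6753884745,1948926513,1897447985,21756420621,6749229581,1956668049,1952473761])
(.N 137 (.L [35178177161,6753423885,9408373385,6749229581,6787439241,6737107593,11019043341,13166518797,1948926513,17998308105,1956667985])
(.L [1947877937,1897447985,21756420621,11019043341,13166518797,17998308105,1948918321,19609045005,37654448195,13499500163]))))))))))))))
(.N 81 (.N 38 (.L [1889034833])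
(.N 42 (.L [1890083409])
(.N 44 (.L [1890607697])
(.N 70 (.L [1897439793])
(.N 74 (.L [1898488369])
(.N 162 (.L [21756420621])
(.N 164 (.L [1922064977])
(.N 168 (.L [1923113553])
(.N 290 (.L [38936289805])
(.N 292 (.L [1955619409])
(.N 296 (.L [1956667985])
(.N 134 (.L [17998308105,17998307913,1914249777,1914257969,17988890673,17988898865,17988988977,6749229581,1948918321,11019108877,36788814349])
(.L [36788814349,6737107721,13166522381,1906336401,1915306545,1947877937,6732419597,6749229581,1948918321,37604066947])))))))))))))
(.N 145 (.N 38 (.L [1889034897])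
(.L [13166518797,1905287825,1956668049,1914249777,1906336401,1915298353,1955619473,38936322573,1947877937,1898496561,6749229581,11019046925,21756522509,6753884745,6782849549,9398988849,1902142113,1948918321]))
(.N 273 (.L [13166584333,21756518925,1948918321,1947869745,1906336529,1923113745,1905287953,1922065169,1898496561,1915306545,6787043853,9408373385,6732419597,19609043469,17988997169,20441090115,11884693123])
(.N 70 (.N 25 (.L [9398923825])
(.N 41 (.L [9398932017])
(.N 56 (.L [9398939697])
(.N 97 (.L [1897447985])
(.N 137 (.L [9408373385])
(.N 152 (.L [9398988849])
(.N 168 (.L [9398997041])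
(.N 265 (.L [9408373513])
(.N 280 (.L [9399054385])
(.N 296 (.L [9399062577])
(.N 73 (.L [6736613901,17998307913,35178177097,6732419597,6753884745,6787439177,1915306545,1948926513,19608946701])
(.N 161 (.L [1914257969,1915306545,11019043341,36788847117,1902142113,1947877937,35705636913,19608948749])
(.N 289 (.L [11019108877,1947877937,1948926513,19609043469,1902142241,18525767729,17988898865])
(.N 37 (.L [9935800881,11018979853,18525735473,35705604657,19608914445,36788783629])
(.N 21 (.L [13166455309,21756389901,38936259085,9935792689,18525727281,35705596465])
(.N 88 (.L [21756424205,38936293389,17988890673,35168759857,18525767729,19608948749])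
(.N 104 (.L [17988898865,35168768049,19608948749,36788817933,18525767729])
(.N 100 (.L [18525767729,19608946701,35705636913,36788815885])
(.N 164 (.L [35705669681,36788848653,9935865905])
(.N 292 (.L [9935931441,11019110413])
(.N 28 (.L [13166458893])
(.N 44 (.L [11018983437])
(.N 52 (.L [9935808561])
.P)))))))))))))))))))))))
(.N 134 (.L [17998308105,17998307913,1914257969,17988997169,17988898865,17988988977,17988890673,1898496561,6753423885,1948926513,11019046925,13166522381,18525767729,19609045005,36788848653])
(.N 262 (.L [35178177097,35178177161,1947877937,35168768049,35168800817,35168759857,35168792625,6787043853,1898496561,1915306545,11019112461,13166587917,35705636913,19609045005])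
(.N 82 (.L [6732419597,11019043341,11019108877,11019046925,11019112461,11019044877,11019110413,6753423885,6787043853,1898496561,19608948749,13166522381,18525767729])
(.N 146 (.L [6749229581,19609043469,19608945165,19609047053,19608948749,19609045005,19608946701,6736613901,1915306545,6787043853,36788850701,21756424205])
(.L [36788850701,1902142241,6753423885,13166522381,18525767729,6787043853,35705669681,1952473761,6787439177,1898496561,14036371075])))))))))))))))))))))

def tC : Tr :=
(.N 76 (.L [10204242993])
(.N 112 (.L [15045499917])
(.N 140 (.L [18794177585])
(.N 176 (.L [23635434509])
(.N 69 (.N 26 (.L [6717708869])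
(.N 42 (.L [6721903173])
(.N 56 (.L [6725573189])
(.N 82 (.L [6732417549])
(.N 98 (.L [6736611853])
(.N 138 (.L [18535178821])
(.N 152 (.L [6750739013])
(.N 168 (.L [6754933317])
(.N 137 (.N 22 (.L [6716660361])
(.N 38 (.L [6720854665])
(.N 52 (.L [6724524681])
(.N 70 (.L [9408373385])
(.N 84 (.L [6732913289])
(.N 100 (.L [6737107593])
(.N 146 (.L [6749229581])
(.N 162 (.L [6753423885])
(.N 134 (.L [17998307913,1914249777,1914257969,17988858417,17988866609,17988890673,17988898865,1898488369,1886413409])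
(.N 74 (.L [1898488369,1898496561,9945244293,9935792689,9935800881,9935857713,9935865905,1886413473])
(.N 148 (.L [6749690441,1917870689,1886413473,1890607697,6733961861,1906336401,22050517515])
(.N 88 (.L [6733961861,1902142113,1886413409,1890607697,1906336401,6753884745])
(.N 164 (.L [6753884745,1922064977,1886413409,1890607761,6738156165])
(.N 104 (.L [6738156165,1906336401,1886413409,1890607697])
(.N 28 (.L [1886413409,1886413473,1890607697])
(.N 44 (.L [1890607697,1890607761])
.P))))))))))))))))
(.N 74 (.L [9945244293,1898488369,1898496561,9935792689,9935800881,9935808561,9935857713,9935865905,1914249777,1884840609,6720854601,9398923825,19608916493,21756393485,13970181651,11300521483])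
(.N 134 (.N 25 (.L [17988858417])
(.N 41 (.L [17988866609])
(.N 73 (.L [17998307913])
(.N 88 (.L [17988890673])
(.N 104 (.L [17988898865])
(.N 145 (.L [1914249777])
(.N 161 (.L [1914257969])
(.N 81 (.L [1889034833,1897439793,21756420621,1922064977,1890607697,1884840545,19608914445,13435414027])
(.N 97 (.L [1884840545,1897447985,19608945165,1917870689,1886413409,21756389901,22025348619])
(.N 146 (.L [19608914445,6749227533,19608918029,19608946701,21756389901,22025348619])
(.N 162 (.L [21756389901,6753421837,21756393485,21756422157,13433312787])
(.N 11 (.N 67 (.N 148 (.L [19871569475,19875763779,19886278155,19890472459])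
(.L [6986667587,22023247427,11300521483]))
(.L [13443802635,6986667651,19907233291]))
(.N 67 (.L [22050514499,3780150819,7005570691])
(.N 131 (.L [5948638739,3796960803])
.P))))))))))))))
(.N 146 (.L [6749227533,19608945165,19608914445,19608916493,19608918029,19608946701,19608948749,1897439793,21756389901,1884840609,1889034897,6724524617,11818503715,22033740299])
(.N 162 (.L [6753421837,21756420621,21756389901,21756391949,21756393485,21756422157,21756424205,1897447985,1884840609,1889034897,6724524617,13970181651,19890459147])
(.N 73 (.N 22 (.L [6716660297])
(.N 38 (.L [6720854601])
(.N 52 (.L [6724524617])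
(.N 148 (.L [6749690441])
(.N 164 (.L [6753884745])
(.N 70 (.L [1897439793,1897447985,9398923825,9398932017,1886413473,1890607761,6733961861])
(.N 145 (.L [1890607761,1905287825,1906336401,1886413409,1901093537,6733961861])
(.L [1890607697,1886413409,6738156165,1901093537,13444854403]))))))))
(.N 88 (.N 133 (.L [6733961861])
(.N 161 (.L [1902142113])
(.N 131 (.L [1897439793,1884840545,1889034897,11824810627,11818503811,11297378947,13444854403,5928658563,13981723267])
(.L [1897439793,1884840545,1889034897,11818519075,13981723143,22037966873,11287941643,5944387139]))))
(.N 81 (.N 38 (.L [1889034833])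
(.N 44 (.L [1890607697])
(.N 70 (.L [1897439793])
(.N 164 (.L [1922064977])
(.N 104 (.L [6738156165,1906336401,1884840545,1886413473,13449048595,13967822484])
(.N 97 (.L [1884840545,1886413409,1917870689,1905287825,1901093537])
(.L [1884840609,1905287825,3771745859,11313153577])))))))
(.N 145 (.L [1905287825,1889034897,1890607761,1906336401,1884840609,9398923825,1917870689,22025348619,11281650307])
(.N 97 (.L [1897447985,1884840545,1886413409,1917870689,1901093537,6738156165,22021678617,6990861891])
(.N 161 (.L [1884840609,1886413473,1901093537,9398923825,6738156165,5919221315,19907236363])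
(.N 104 (.L [6738156165,9398923825,13969395222,13970188819,19871617059,7006619267])
(.N 70 (.N 25 (.L [9398923825])
(.N 41 (.L [9398932017])
(.N 11 (.L [13433312787,11281634851,7018186251])
(.L [22037956115,11313153571]))))
(.N 11 (.L [11280061993,13431739929,22023247379,19871569443])
(.L [13431744025,11280074281,7018186307])))))))))))))))))))))))
(.N 133 (.N 26 (.L [6717708933])
(.N 42 (.L [6721903237])
(.N 56 (.L [6725573253])
(.N 74 (.L [9945244293])
(.N 88 (.L [6733961861])
(.N 104 (.L [6738156165])
(.N 146 (.L [6749227533])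
(.N 162 (.L [6753421837])
(.N 73 (.N 22 (.L [6716660297])
(.N 38 (.L [6720854601])
(.N 52 (.L [6724524617])
(.N 82 (.L [6732419597])
(.N 98 (.L [6736613901])
(.N 134 (.L [17998307913])
(.N 148 (.L [6749690441])
(.N 164 (.L [6753884745])
(.N 70 (.L [1897439793,1897447985,9408373385,9398923825,9398932017,9398988849,9398997041,1915298353])
(.N 138 (.L [1915298353,1915306545,18525727281,18525735473,18525759537,18525767729,1886413409])
(.N 84 (.L [6732913289,1901093537,1886413409,1890607697,1905287825,22559337044])
(.L [1923113553,1918919265,1890607761,6737107593,1886413473]))))))))))))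
(.N 70 (.N 25 (.L [9398923825])
(.N 41 (.L [9398932017])
(.N 81 (.L [1897439793])
(.N 97 (.L [1897447985])
(.N 137 (.L [9408373385])
(.N 152 (.L [9398988849])
(.N 168 (.L [9398997041])
(.N 138 (.L [18525727281,18525735473,1915298353,1915306545,18525743153,18525759537,18525767729,11019044877])
(.N 145 (.L [1889034897,1914249777,13166518797,1905287825,1890607761,11018979853,1884840609])
(.N 161 (.L [1884840609,1914257969,11019043341,1901093537,1886413473,13166455309])
(.N 82 (.L [11018979853,11018983437,11019044877,13166455309,13435414027])
(.N 98 (.L [13166455309,13166458893,13166520333,13433312787])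
(.N 11 (.L [13433312787,11281634851,7018186251])
(.L [22037956115,11313153571]))))))))))))))
(.N 138 (.L [1915298353,1915306545,18525727281,18525735473,18525743153,18525759537,18525767729,1884840545,1889034833,17988858417,11018981901,13166458893,22560116243,19907233291])
(.N 82 (.L [11019043341,11018979853,11018981901,11018983437,11019044877,11019046925,1914249777,13166455309,1884840545,1889034833,6724524681,20408438307,13460582923])
(.N 98 (.L [13166518797,13166455309,13166457357,13166458893,13166520333,13166522381,1914257969,1884840545,1889034833,6724524681,22560116243,11317301771])
(.N 137 (.L [6720854665,6716660361,6724524681,6732913289,6737107593,1922064977,17988858417,1886413473,1890607761,1918919265,22587385411])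
(.N 81 (.L [1922064977,1923113553,1890607697,1889034833,17988858417,1886413409,1905287825,1901093537,7019234883,19870008873])
(.N 145 (.L [1914249777,1889034897,1890607761,1905287825,1884840545,1886413473,22025351691,22559337044,20439910947])
(.N 97 (.L [1884840545,1886413409,1917870689,1918919265,1914257969,22021678617,22559337044,6990861955])
(.N 161 (.L [1914257969,1884840609,1886413473,1901093537,20407667238,22560123411,19877876235])
(.N 67 (.L [17988858417,19870025257,5912929859,22562220611,20444105283,11300521603])
(.N 134 (.L [17988858417,17988866609,22560123411,20408453667,7018186251])
(.L [22559336982,20407667238,5919221379,19871569443])))))))))))))))))))))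
(.N 73 (.N 22 (.L [6716660297])
(.N 38 (.L [6720854601])
(.N 52 (.L [6724524617])
(.N 82 (.L [6732419597])
(.N 98 (.L [6736613901])
(.N 134 (.L [17998307913])
(.N 148 (.L [6749690441])
(.N 164 (.L [6753884745])
(.N 70 (.L [9408373385,1897439793,1897447985,9398923825,9398932017,9398939697,9398988849,9398997041,1915298353,1885889185,9935792689,19608914445,21756393485,13433312787,11297379363])
(.N 146 (.L [6749229581,19608945165,19608916493,19608914445,19608918029,19608948749,19608946701,1898488369,1915298353,21756391949,1885889185,11279799850,3772794435,22571656711])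
(.N 162 (.L [6753423885,21756420621,21756391949,21756389901,21756393485,21756424205,21756422157,1898496561,1915298353,1885889185,5920269891,20403997284,14002750983])
(.N 138 (.N 21 (.L [18525727281])
(.N 37 (.L [18525735473])
(.N 84 (.L [18525759537])
(.N 100 (.L [18525767729])
(.N 145 (.L [1915298353])
(.N 161 (.L [1915306545])
(.N 81 (.L [1890083409,1898488369,1890607697,1923113553,1885889121,13973333511])
(.N 97 (.L [1885889121,1898496561,1886413409,1918919265,13970181651])
(.N 7 (.N 67 (.N 152 (.L [20408438339,20412632643,20424197639,20428391943])
(.L [7523536451,22560116291,11838440967]))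
(.L [11825858055,13998556679,22560116243]))
(.N 67 (.L [5912929859,20445152835,7539295875])
(.N 131 (.L [5949687315,3798009379])
.P)))))))))))
(.N 84 (.N 137 (.L [6732913289])
(.N 161 (.L [1901093537])
(.N 131 (.L [1898488369,1885889121,1890083473,11288990339,11281634947,11833199235,13980674691,5927609987,13443805827])
(.L [1898488369,1885889121,1890083473,11281650211,13443805707,22575884309,11825859079,5945435715]))))
(.N 81 (.N 42 (.L [1890083409])
(.N 44 (.L [1890607697])
(.N 74 (.L [1898488369])
(.N 168 (.L [1923113553])
(.N 100 (.L [6737107593,1905287825,1885889121,1886413473,13984868883,20403996260])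
(.N 97 (.L [1885889121,1886413409,1918919265,1906336401,1902142113])
(.L [1885889185,1906336401,3772794435,11851073061])))))))
(.N 145 (.L [1890607761,1905287825,1890083473,1906336401,9935792689,1886413473,1885889121,11825859203,20445152775])
(.N 97 (.L [1898496561,1885889121,1886413409,1918919265,1902142113,6737107593,22559598101,7527730755])
(.N 161 (.L [1885889185,1886413473,1902142113,9935792689,6737107593,5920269891,20445153799])
(.N 100 (.L [6737107593,9935792689,13431477786,13433319955,20408485923,7542441603])
(.N 74 (.N 21 (.L [9935792689])
(.N 37 (.L [9935800881])
(.N 7 (.L [13970181651,11818503715,7556105735])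
(.L [22575875603,11851073059]))))
(.N 7 (.L [13969657365,11817979429,22560116243,20408438307])
(.L [13969663509,11817993765,7556105795])))))))))))))))))))))
(.N 137 (.N 22 (.L [6716660361])
(.N 38 (.L [6720854665])
(.N 52 (.L [6724524681])
(.N 70 (.L [9408373385])
(.N 84 (.L [6732913289])
(.N 100 (.L [6737107593])
(.N 146 (.L [6749229581])
(.N 162 (.L [6753423885])
(.N 134 (.L [1914249777,1914257969,17988858417,17988866609,17988874289,17988890673,17988898865,1898488369,1885889121,18525727281,11018979853,13166458893,22023247379,19904091171])
(.N 74 (.N 21 (.L [9935792689])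
(.N 37 (.L [9935800881])
(.N 81 (.L [1898488369])
(.N 97 (.L [1898496561])
(.N 148 (.L [9935857713])
(.N 164 (.L [9935865905])
(.N 145 (.L [1890083473,1915298353,13166518797,1906336401,1890607761,11018981901,1885889185])
(.N 161 (.L [1885889185,1915306545,11019043341,1902142113,1886413473,13166457357])
(.N 82 (.L [11018981901,11018983437,11019046925,13166457357,13973333511])
(.N 98 (.L [13166457357,13166458893,13166522381,13970181651])
(.N 7 (.L [13970181651,11818503715,7556105735])
(.L [22575875603,11851073059]))))))))))))
(.N 82 (.L [11019043341,11018981901,11018979853,11018983437,11019046925,11019044877,1915298353,13166457357,1885889121,1890083409,3772794499,13961538196])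
(.N 98 (.L [13166518797,13166457357,13166455309,13166458893,13166522381,13166520333,1915306545,1885889121,1890083409,5920269955,11814062756])
(.N 81 (.L [1923113553,1922064977,1890607697,1890083409,1906336401,18525727281,1885889185,1917870689,20415793731,11818503715])
(.N 145 (.L [1915298353,1890083473,1890607761,1906336401,1885889121,1886413473,22563269127,11817732772,19904090659])
(.N 97 (.L [1885889121,1886413409,1918919265,1917870689,1915306545,22559598101,11817732772,7527730819])
(.N 161 (.L [1915306545,1885889185,1886413473,1902142113,19869749802,22023254547,20415793671])
(.N 67 (.L [18525727281,20407944741,5912929859,22026400323,19908284995,11838441091])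
(.N 138 (.L [18525727281,18525735473,22023254547,19871584803,7556105735])
(.L [19869749802,22021419546,5920269955,20408438307])))))))))))))))))))
(.N 81 (.N 38 (.L [1889034833])
(.N 42 (.L [1890083409])
(.N 44 (.L [1890607697])
(.N 70 (.L [1897439793])
(.N 74 (.L [1898488369])
(.N 162 (.L [21756420621])
(.N 164 (.L [1922064977])
(.N 168 (.L [1923113553])
(.N 161 (.L [11019043341,1914257969,1915306545,1884840609,1885889185,1886413473,1901093537,1902142113,19608945165,13166518797,13973334535,13435417099,20439910979])
(.N 97 (.L [19608945165,1884840545,1885889121,1886413409,1917870689,1918919265,13166518797,18525727281,17988858417,11018979853,11287941643,13973333511])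
(.N 134 (.L [1914249777,17988858417,17988866609,17988874289,17988890673,17988898865,13166455309,11018979853,18525743153,19608946701,11281634851])
(.N 138 (.L [1915298353,18525727281,18525735473,18525743153,18525759537,18525767729,13166457357,11018981901,19608948749,7523536451])
(.N 98 (.L [13166518797,13166455309,13166457357,13166458893,13166520333,13166522381,11018979853,19608916493,7529827907])
(.N 100 (.L [1905287825,19608946701,11018979853,13435417099,13984868883,20407914084,11300524675,3772794435])
(.N 104 (.L [1906336401,19608948749,11018979853,13969401366,13973334535,19877908491,3785393795])
(.N 37 (.L [11018979853,19608914445,11817979429,20414745155,11280061993,3772794499])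
(.N 41 (.L [11018981901,19608916493,11280061993,19878924867,11851073031])
(.N 35 (.N 67 (.N 148 (.L [19877873219,19878921795,19886278179,19887326755])
(.L [3771745859,20415792707,11297363491]))
(.L [19887298083,11287938691,20415792647]))
(.N 67 (.L [7002424963,19904075331,7523536451])
(.N 131 (.L [7556105735,7018186251])
.P))))))))))))))))))))
(.N 145 (.N 38 (.L [1889034897])
(.N 42 (.L [1890083473])
(.N 44 (.L [1890607761])
(.N 98 (.L [13166518797])
(.N 100 (.L [1905287825])
(.N 104 (.L [1906336401])
(.N 134 (.L [1914249777])
(.N 138 (.L [1915298353])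
(.N 97 (.L [19608945165,1897447985,1898496561,1884840545,1885889121,1886413409,1917870689,1918919265,11019043341,21756389901,22025351691,11825859079])
(.N 161 (.L [11019043341,1884840609,1885889185,1886413473,1901093537,1902142113,9935792689,9398923825,19608914445,19877876235,22563268103])
(.N 70 (.L [9398923825,9398932017,9398939697,9398988849,9398997041,9935792689,19608914445,21756393485,11019044877,7018186251])
(.N 74 (.L [9935792689,9935800881,9935808561,9935857713,9935865905,21756391949,19608916493,11019046925,7523536515])
(.N 162 (.L [21756389901,21756391949,21756393485,21756422157,21756424205,19608914445,11018981901,22563269639])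
(.N 82 (.N 37 (.L [11018979853])
(.N 41 (.L [11018981901])
(.N 164 (.L [11019044877])
(.N 168 (.L [11019046925])
(.N 35 (.L [11818503715,11287938571,19878921795])
(.L [20424197639,11313153547]))))))
(.N 67 (.L [19608914445,19870025257,7523536451,22562220611,22051566147,11297363587])
(.N 146 (.L [19608914445,19608916493,22563269127,22025351691,3796960803])
(.L [22559336982,22021419546,7523536515,19877873163])))))))))))))))))
(.N 97 (.N 22 (.L [1884840545])
(.N 26 (.L [1885889121])
(.N 28 (.L [1886413409])
(.N 70 (.L [1897447985])
(.N 74 (.L [1898496561])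
(.N 146 (.L [19608945165])
(.N 148 (.L [1917870689])
(.N 152 (.L [1918919265])
(.N 134 (.L [1914257969,17988866609,17988858417,17988874289,17988898865,17988890673,11018979853,13166455309,18525743153,21756422157,13433312787])
(.N 138 (.L [1915306545,18525735473,18525727281,18525743153,18525767729,18525759537,11018981901,13166457357,21756424205,7527730755])
(.N 82 (.L [11019043341,11018979853,11018981901,11018983437,11019044877,11019046925,13166455309,21756391949,7529827907])
(.N 84 (.L [1901093537,21756422157,13166455309,11287941643,11833199139,22559592020,13443805827,5920269891])
(.N 88 (.L [1902142113,21756424205,13166455309,11817731622,11825859079,22025383947,5928683139])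
(.N 21 (.L [13166455309,21756389901,13969657365,22562220611,13431739929,5920269955])
(.N 25 (.L [13166457357,21756391949,13431739929,22026400323,14002750983])
(.N 19 (.N 67 (.N 164 (.L [22025348675,22026397251,22037956115,22039004691])
(.L [5919221315,22563268163,13449041427]))
(.L [22055753235,13973333511,5919221379]))
(.N 67 (.L [7023429187,22023247427,7543490055])
(.N 131 (.L [7560300039,7022380555])
.P))))))))))))))))))
(.N 161 (.N 22 (.L [1884840609])
(.N 26 (.L [1885889185])
(.N 28 (.L [1886413473])
(.N 82 (.L [11019043341])
(.N 84 (.L [1901093537])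
(.N 88 (.L [1902142113])
(.N 134 (.L [1914257969])
(.N 138 (.L [1915306545])
(.N 70 (.L [9398932017,9398923825,9398939697,9398997041,9398988849,9935800881,21756389901,19608918029,13166520333,7022380555])
(.N 74 (.L [9935800881,9935792689,9935808561,9935865905,9935857713,19608916493,21756391949,13166522381,7527730819])
(.N 146 (.L [19608914445,19608916493,19608918029,19608946701,19608948749,21756389901,13166457357,20415794183])
(.N 98 (.N 21 (.L [13166455309])
(.N 25 (.L [13166457357])
(.N 148 (.L [13166520333])
(.N 152 (.L [13166522381])
(.N 19 (.L [13970181651,13435414027,22026397251])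
(.L [22575875591,13464831499]))))))
(.N 67 (.L [21756389901,22021703193,7527730755,20414745155,19908284995,13449041539])
(.N 162 (.L [21756389901,21756391949,20415793671,19877876235,5948638739])
(.L [19869749802,20407667238,7527730819,22025348619])))))))))))))))
(.N 84 (.N 138 (.L [18525759537])
(.N 162 (.L [21756422157])
(.N 131 (.N 168 (.L [9398997041,11019046925,22582930516,22582930004,11281715331,11288006787,11285909635,11289055363,22582922836,22582928980,11297443971,11300589699,11301638275,22582953556,13166457357])
(.N 104 (.L [17988898865,19608948749,13980675203,13980674691,11301573763,11301573251,13980667523,13980673667,11301557891,11301570179,13980739715,9398923825,11018979853,13166458893])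
(.N 100 (.L [19608946701,11300525187,11300524675,13443806339,13443802755,13443805827,11300521603,13443870851,9935792689,11018979853,9398939697,13166458893,17988890673])
(.L [11833183875,9398923825,9935792689,17988866609,11313153571,7001376387,13166522381,11288974979,5927609987,11019044877,11281650819,19608914445]))))
(.N 168 (.L [9398997041,11019046925,13166458893,9935808561,19608918029,17988874289,22559599700,22559337044,22571689991,11300589579,22575884307,11313172515,22588467267,22021682201])
(.N 41 (.N 70 (.L [9398932017])
(.L [11018981901,19608916493,17988866609,11317301771,2974863401,11281650211,9935808561,19886278185,13166457357,11279815210,11817979429,20406094948]))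
(.N 164 (.N 74 (.L [9935865905])
(.N 82 (.L [11019044877])
(.N 11 (.L [11317302283,22033740811,22033740299,22033737227,22033772555,11317298699,22033761803,13166455309,19608918029,9398939697])
(.N 67 (.L [13166455309,19608918029,9398939697,17988858417,22025352259,19886278186,22019057219,11828743332,20444105283])
(.N 88 (.L [17988890673,11833264163,19608918029,13166458893,9398939697,11817995428,11817732772,22037966867])
(.L [13166458893,9398939697,19608918029,17988858417,11279812138,22021416474,13998500871]))))))
(.N 152 (.N 70 (.L [9398988849])
(.N 98 (.L [13166522381])
(.N 35 (.L [11314156579,20423134243,20423133731,11314140707,20423118371,20423165987,20423149091,9935792689,17988858417])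
(.N 100 (.L [19608946701,13443870731,9935792689,17988858417,11018983437,20407929956,20424214565,20415825927])
(.L [17988858417,9935792689,11018979853,19608918029,11287942155,20415794183,19904122947])))))
(.N 148 (.N 74 (.L [9935857713])
(.N 98 (.L [13166520333])
(.N 104 (.L [17988898865,19608948749,19886297130,19886297099,19886297123,9398923825,11018979853,13973399559])
(.L [9398923825,11018979853,19608918029,17988874289,19886278186,13443806219,11833199651]))))
(.L [9935792689,9398923825,13166458893,11018979853,19608918029,17988874289,11287942155,11833199651,13984869395])))))))))
(.N 37 (.N 74 (.L [9935800881])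
(.N 82 (.L [11018979853])
(.N 138 (.L [18525735473])
(.N 146 (.L [19608914445])
(.N 152 (.L [9398988849,13166522381,17988866609,21756389901,20407929893,20408453667,20415793671,20407667300,20414745155,11851089957,22560123923,13969720980])
(.N 88 (.L [21756424205,17988890673,9398932017,13166455309,11817995301,11818519075,11825859079,11817732772,11824810627,22560123923,19890459659])
(.N 25 (.L [21756391949,9398923825,13166457357,17988858417,13431484954,22021674521,22559599637,19871584803,7529827971,5932877331])
(.N 148 (.N 98 (.L [13166520333])
(.N 104 (.L [17988898865,9398932017,21756389901,13969665172,13967822484,19877908491,13970253843,13966059651])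
(.L [21756389901,17988866609,9398939697,19871585315,13431477786,22587386947,5919221379])))
(.N 70 (.L [9398932017,9398939697,9398997041,13166455309,21756393485,17988898865,13431477786,5919221315])
(.N 134 (.L [17988866609,17988874289,17988898865,13166455309,21756393485,13431477786,22560123923])
(.N 28 (.L [13166458893,21756393485,13431477786,3771745859,7523536515,13969402390])
(.N 21 (.L [13166455309,21756389901,13969402390,22559591957,13431477786])
(.N 26 (.L [13431477786,22021441050,13969395222,5919221379])
(.L [13969395222,7005570571,5948638739]))))))))))))))
(.N 70 (.N 25 (.L [9398923825])
(.N 41 (.L [9398932017])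
(.N 56 (.L [9398939697])
(.N 152 (.L [9398988849])
(.N 168 (.L [9398997041])
(.N 21 (.L [13166455309,18525727281,21756389901,9935792689,11018983437,19608946701,17988890673,13969665045,3771745859,22050518027])
(.N 164 (.L [11019044877,9935865905,13166458893,18525743153,19608918029,17988890673,22037956122,19907236875,14001646611])
(.N 104 (.L [17988898865,19608948749,11018983437,13166458893,9935808561,21756424205,18525767729,13969665172])
(.N 148 (.L [9935857713,13166520333,11018983437,21756393485,18525743153,17988890673,19608946701])
(.N 100 (.L [18525767729,19608946701,13166458893,11018983437,9935808561,17988890673])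
(.N 88 (.L [17988890673,21756424205,11018983437,9935808561,13166458893])
(.N 28 (.L [13166458893,21756393485,11018983437,9935808561])
(.N 44 (.L [11018983437,19608918029,9935808561])
(.N 52 (.L [9935808561,18525743153])
.P))))))))))))))
(.N 134 (.N 25 (.L [17988858417])
(.N 41 (.L [17988866609])
(.N 56 (.L [17988874289])
(.N 88 (.L [17988890673])
(.N 104 (.L [17988898865])
(.N 21 (.L [21756389901,18525727281,9935792689,13166455309,19608918029,11019044877,22559599637,20408454179,13435417731])
(.N 100 (.L [18525767729,19608946701,21756393485,11018983437,9935808561,13166520333,22574803987,20407929956])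
(.N 74 (.L [9935808561,9935857713,9935865905,21756393485,19608918029,11019046925,13166522381])
(.L [18525743153,21756393485,19608918029,11019046925,13166522381,22050518027])))))))))
(.N 98 (.N 21 (.L [13166455309])
(.N 25 (.L [13166457357])
(.N 28 (.L [13166458893])
(.N 148 (.L [13166520333])
(.N 152 (.L [13166522381])
(.N 82 (.L [11018981901,11018983437,11019046925,11019044877,9935808561,18525767729,19608948749,21756424205])
(.N 146 (.L [19608916493,19608918029,19608946701,19608948749,9935808561,21756424205,22563269639])
(.L [18525743153,21756424205,9935865905,22559329814,13433320467,7543490179]))))))))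
(.N 164 (.N 74 (.L [9935865905])
(.N 82 (.L [11019044877])
(.N 67 (.L [19608916493,18525727281,21756391949,22019060803,22591581251,22026393155,11828743332,19907236931,22025348675,20444104259])
(.N 88 (.L [21756424205,19608916493,18525743153,11817995428,11818584099,11825924103,22023286803,22037966873,22050549771])
(.L [19608916493,21756393485,18525743153,22021682201,19907236875,22591581203,20415792647,13970188931])))))
(.N 100 (.N 138 (.L [18525767729])
(.N 146 (.L [19608946701])
(.N 131 (.L [21756391949,11018981901,9935792689,13429126275,11837394051,13436458627,13435414147,13433385091,13984869507])
(.L [21756391949,11018981901,9935808561,13433320467,20424214566,19890459659,13973335047,22555929155]))))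
(.N 162 (.L [21756391949,21756389901,21756393485,21756424205,11018981901,18525743153,19608918029,9935857713,20415794183,14002750998])
(.N 148 (.N 74 (.L [9935857713])
(.N 104 (.L [19608948749,11018981901,18525727281,13969665172,13961537172,19871617059,13973399559,13972351107])
(.L [18525727281,19608916493,11018983437,19877876747,11849976867,22587386947,7523536515])))
(.N 82 (.L [11018981901,11018983437,11019046925,9935792689,18525743153,19608948749,11817731622,7523536451])
(.N 146 (.L [19608916493,19608918029,19608948749,9935792689,18525743153,11817731622,22563269639])
(.N 52 (.L [9935808561,18525743153,6986667587,5919221379,11817731622,13969402390])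
(.N 21 (.L [9935792689,18525727281,13969402390,22559598101,11817731622])
(.N 7 (.L [13969395222,11817717286,22560116243,20408438307])
(.L [13969401366,11817731622,7556105795])))))))))))))))))))))))))))

def tD : Tr :=
(.N 262 (.L [35178177097])
(.N 266 (.L [35715048005])
(.N 274 (.L [36788814349])
(.N 290 (.L [38936289805])
(.N 268 (.L [35974055473])
(.N 276 (.L [6783244873])
(.N 292 (.L [6787439177])
(.N 280 (.L [6784293445])
(.N 296 (.L [6788487749])
(.N 304 (.L [40815330829])
.P))))))))))

def tE : Tr :=
(.N 193 (.L [25916892174])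
(.N 194 (.L [26051371533])
(.N 196 (.L [26310107698])
(.N 200 (.L [26846978610])
(.N 208 (.L [27930401805])
(.N 224 (.L [30077885453])
(.N 448 (.L [60247008269])
.P)))))))

theorem runB : run [pg0, pg1] (K6 ||| K7 ||| K8) tB inc0 0 30 = true := by decide +kernel

theorem runC : run [qg0, qg1, ps2, ps3, ps4, ps5] (KU ||| K6 ||| K7) tC inc0 0 28 = true := by
  decide +kernel

theorem runD : run [poD] (K6 ||| K7) tD inc0 exD 0 = true := by decide +kernel

theorem runE : run [poE] 0 tE inc0 0 0 = true := by decide +kernel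

/-! ### Transfer to hypergraphs -/

def tr (φ : Fin 9 → ℕ) (m : ℕ) : Finset ℕ :=
  (univ.filter (fun i : Fin 9 => m.testBit i = true)).image φ

def Fs (H : Finset (Finset ℕ)) (φ : Fin 9 → ℕ) : Finset ℕ :=
  (range 512).filter (fun m => tr φ m ∉ H)

def cnt (H : Finset (Finset ℕ)) (φ : Fin 9 → ℕ) (K : ℕ) : ℕ :=
  ((range 512).filter (fun m => K.testBit m = true ∧ tr φ m ∈ H)).card

def mk3 (i j k : Fin 9) : ℕ := (1 <<< i.val) ||| (1 <<< j.val) ||| (1 <<< k.val)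

theorem mem_tr {φ : Fin 9 → ℕ} (hφ : Function.Injective φ) (i : Fin 9) (m : ℕ) :
    φ i ∈ tr φ m ↔ m.testBit i = true := by
  unfold tr
  rw [hφ.mem_finset_image]
  simp

theorem tr_inter {φ : Fin 9 → ℕ} (hφ : Function.Injective φ) (a b : ℕ) :
    tr φ a ∩ tr φ b = tr φ (a &&& b) := by
  unfold tr
  rw [← Finset.image_inter _ _ hφ, ← Finset.filter_and]
  simp

theorem tr_zero (φ : Fin 9 → ℕ) : tr φ 0 = ∅ := by simp [tr]

theorem tr_nonempty (φ : Fin 9 → ℕ) {m : ℕ} (h : m < 512) (h0 : m ≠ 0) : (tr φ m).Nonempty := by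
  obtain ⟨i, hi⟩ := Nat.exists_testBit_of_ne_zero h0
  have hi9 : i < 9 := by
    by_contra hc
    have : m < 2 ^ i := lt_of_lt_of_le h (by
      calc 512 = 2 ^ 9 := by norm_num
        _ ≤ 2 ^ i := Nat.pow_le_pow_right (by norm_num) (by omega))
    rw [Nat.testBit_eq_false_of_lt this] at hi
    cases hi
  exact ⟨φ ⟨i, hi9⟩, Finset.mem_image.2 ⟨⟨i, hi9⟩, by simpa using hi, rfl⟩⟩

theorem tr_mk3 (φ : Fin 9 → ℕ) (i j k : Fin 9) : tr φ (mk3 i j k) = {φ i, φ j, φ k} := by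
  have : (univ.filter (fun l : Fin 9 => (mk3 i j k).testBit l = true)) = {i, j, k} := by
    ext l
    simp only [Finset.mem_filter, Finset.mem_univ, true_and, mk3, Nat.testBit_lor, Bool.or_eq_true,
      testBit_one_shl, Finset.mem_insert, Finset.mem_singleton, Fin.ext_iff]
    tauto
  unfold tr
  rw [this]
  simp [Finset.image_insert]

theorem mk3_lt (i j k : Fin 9) : mk3 i j k < 512 := by
  have h : ∀ i : Fin 9, 1 <<< i.val < 2 ^ 9 := by decide
  exact Nat.or_lt_two_pow (Nat.or_lt_two_pow (h i) (h j)) (h k)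

structure Ctx (H : Finset (Finset ℕ)) (U : Finset ℕ) (φ : Fin 9 → ℕ) : Prop where
  inj : Function.Injective φ
  hU : ∀ u, u ∈ U ↔ ∃ i : Fin 9, i.val < 6 ∧ φ i = u
  free : P4Free H
  m3 : ¬HasM3 H
  card3 : ∀ e ∈ H, e.card = 3
  c4 : tr φ 13 ∈ H ∧ tr φ 14 ∈ H ∧ tr φ 49 ∈ H ∧ tr φ 50 ∈ H

theorem Ctx.path {H U φ} (h : Ctx H U φ) (q : ℕ) (hq : pok q = true) :
    ∃ i ∈ Fs H φ, (cm q).testBit i = true := by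
  have hlt : ∀ n : ℕ, n % 512 < 512 := fun n => Nat.mod_lt _ (by norm_num)
  unfold pok at hq
  unfold cm
  have ha := hlt q
  have hb := hlt (q / 512)
  have hc := hlt (q / 262144)
  have hd := hlt (q / 134217728)
  generalize q % 512 = a at *
  generalize q / 512 % 512 = b at *
  generalize q / 262144 % 512 = c at *
  generalize q / 134217728 % 512 = d at *
  have hne : ∀ a b : ℕ, a < 512 → disj a b = false → (tr φ a ∩ tr φ b).Nonempty := by
    intro a b ha hab
    rw [tr_inter h.inj]
    apply tr_nonempty
    · exact lt_of_le_of_lt Nat.and_le_left ha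
    · intro h0
      rw [disj_iff.2 h0] at hab
      cases hab
  have hem : ∀ a b : ℕ, disj a b = true → tr φ a ∩ tr φ b = ∅ := by
    intro a b hab
    rw [tr_inter h.inj, disj_iff.1 hab, tr_zero]
  by_contra hcon
  push Not at hcon
  have key : ∀ i, i < 512 → ((1 <<< a ||| 1 <<< b ||| 1 <<< c ||| 1 <<< d) : ℕ).testBit i = true →
      tr φ i ∈ H := by
    intro i hi hti
    by_contra hni
    exact hcon i (by simp [Fs, hi, hni]) hti
  simp only [Nat.testBit_lor, Bool.or_eq_true, testBit_one_shl] at key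
  have Ha := key a ha (by simp)
  have Hb := key b hb (by simp)
  have Hc := key c hc (by simp)
  have Hd := key d hd (by simp)
  simp only [pathB, Bool.or_eq_true, Bool.and_eq_true, Bool.not_eq_true'] at hq
  rcases hq with ⟨⟨⟨⟨⟨h1, h2⟩, h3⟩, h4⟩, h5⟩, h6⟩ | ⟨⟨h1, h2⟩, h3⟩
  · exact h.free ⟨_, Ha, _, Hb, _, Hc, _, Hd, hne _ _ ha h1, hne _ _ hb h2, hne _ _ hc h3,
      hem _ _ h4, hem _ _ h5, hem _ _ h6⟩
  · exact h.m3 ⟨_, Ha, _, Hb, _, Hc, hem _ _ h1, hem _ _ h2, hem _ _ h3⟩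

theorem bit_lt {M i : ℕ} (hM : M >>> 512 = 0) (h : M.testBit i = true) : i < 512 := by
  by_contra hc
  obtain ⟨j, rfl⟩ := Nat.exists_eq_add_of_le (not_lt.1 hc)
  have h2 : (M >>> 512).testBit j = M.testBit (512 + j) := Nat.testBit_shiftRight _
  rw [h, hM, Nat.zero_testBit] at h2
  cases h2

theorem inc0_hi : inc0 >>> 512 = 0 := by decide +kernel
theorem exD_hi : exD >>> 512 = 0 := by decide +kernel

theorem inc0_bits : ∀ i < 512, inc0.testBit i = true → i = 13 ∨ i = 14 ∨ i = 49 ∨ i = 50 := by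
  decide +kernel

theorem Ctx.runH {H U φ} (h : Ctx H U φ) (pos : List ℕ) (K : ℕ) (t : Tr) (exc s : ℕ)
    (hrun : run pos K t inc0 exc s = true)
    (hexc : ∀ i, exc.testBit i = true → i ∈ Fs H φ)
    (hs : ((range 512).filter (fun i => K.testBit i = true ∧ exc.testBit i = false)).card
      ≤ s + cnt H φ K) :
    ∃ p ∈ pos, ∀ i, p.testBit i = true → tr φ i ∉ H := by
  by_contra hcon
  push Not at hcon
  refine run_sound (Fs H φ) pos K h.path ?_ t inc0 exc s ?_ hexc hrun ?_
  · intro p hpp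
    obtain ⟨i, hi, hiH⟩ := hcon p hpp
    exact ⟨i, by simp [Fs, hiH], hi⟩
  · intro i hi hiF
    have := inc0_bits i (bit_lt inc0_hi hi) hi
    have hn : tr φ i ∉ H := (Finset.mem_filter.1 hiF).2
    obtain ⟨h1, h2, h3, h4⟩ := h.c4
    rcases this with rfl | rfl | rfl | rfl
    · exact hn h1
    · exact hn h2
    · exact hn h3
    · exact hn h4
  · have hun : (Fs H φ).filter (fun i => K.testBit i = true ∧ exc.testBit i = false) ∪
        (range 512).filter (fun m => K.testBit m = true ∧ tr φ m ∈ H) ⊆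
        (range 512).filter (fun i => K.testBit i = true ∧ exc.testBit i = false) := by
      intro i hi
      simp only [Fs, Finset.mem_union, Finset.mem_filter] at hi ⊢
      rcases hi with hi | hi
      · exact ⟨hi.1.1, hi.2⟩
      · refine ⟨hi.1, hi.2.1, ?_⟩
        by_contra hc
        have := hexc i (by simpa using hc)
        exact (Finset.mem_filter.1 this).2 hi.2.2
    have hdis : Disjoint ((Fs H φ).filter (fun i => K.testBit i = true ∧ exc.testBit i = false))
        ((range 512).filter (fun m => K.testBit m = true ∧ tr φ m ∈ H)) := by
      rw [Finset.disjoint_left]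
      intro i hi hi'
      simp only [Fs, Finset.mem_filter] at hi hi'
      exact hi.1.2 hi'.2.2
    have h1 := Finset.card_le_card hun
    rw [Finset.card_union_of_disjoint hdis] at h1
    unfold cnt at hs
    omega

theorem cnt_le {H φ} {p K : ℕ} (hp : ∀ i, p.testBit i = true → tr φ i ∉ H) :
    cnt H φ K ≤ ((range 512).filter (fun i => K.testBit i = true ∧ p.testBit i = false)).card := by
  apply Finset.card_le_card
  intro i hi
  simp only [Finset.mem_filter] at hi ⊢
  refine ⟨hi.1, hi.2.1, ?_⟩
  by_contra hc
  exact hp i (by simpa using hc) hi.2.2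

theorem cnt_lor {H φ} {K L : ℕ} (hd : disj K L = true) :
    cnt H φ (K ||| L) = cnt H φ K + cnt H φ L := by
  unfold cnt
  rw [← Finset.card_union_of_disjoint]
  · generalize range 512 = R
    refine congrArg Finset.card ?_
    ext i
    simp only [Finset.mem_filter, Finset.mem_union, Nat.testBit_lor, Bool.or_eq_true]
    tauto
  · rw [Finset.disjoint_left]
    intro i hi hi'
    simp only [Finset.mem_filter] at hi hi'
    have := disj_testBit hd i hi.2.1
    rw [hi'.2.1] at this
    cases this

/-- number of edges inside `U` -/
def hu (H : Finset (Finset ℕ)) (U : Finset ℕ) : ℕ := (H.filter (fun e => e ⊆ U)).card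

/-- degree of `w` -/
def dg (H : Finset (Finset ℕ)) (w : ℕ) : ℕ := (H.filter (fun e => w ∈ e)).card

theorem bits_KU : ∀ i j k : Fin 9, i.val < 6 → j.val < 6 → k.val < 6 → i ≠ j → i ≠ k → j ≠ k →
    KU.testBit (mk3 i j k) = true := by decide +kernel

theorem bits_K : ∀ i j : Fin 9, i.val < 6 → j.val < 6 → i ≠ j →
    K6.testBit (mk3 i j 6) = true ∧ K7.testBit (mk3 i j 7) = true ∧ K8.testBit (mk3 i j 8) = true := by
  decide +kernel

theorem Ctx.coverU {H U φ} (h : Ctx H U φ) {e : Finset ℕ} (he : e ∈ H) (heU : e ⊆ U) :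
    ∃ m < 512, e = tr φ m ∧ KU.testBit m = true := by
  obtain ⟨a, b, c, hab, hac, hbc, rfl⟩ := Finset.card_eq_three.1 (h.card3 e he)
  obtain ⟨i, hi, rfl⟩ := (h.hU a).1 (heU (by simp))
  obtain ⟨j, hj, rfl⟩ := (h.hU b).1 (heU (by simp))
  obtain ⟨k, hk, rfl⟩ := (h.hU c).1 (heU (by simp))
  exact ⟨mk3 i j k, mk3_lt _ _ _, (tr_mk3 φ i j k).symm, bits_KU i j k hi hj hk
    (fun h => hab (by rw [h])) (fun h => hac (by rw [h])) (fun h => hbc (by rw [h]))⟩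

theorem Ctx.coverW {H U φ} (h : Ctx H U φ) {e : Finset ℕ} (he : e ∈ H) (p : Fin 9)
    (hpe : φ p ∈ e) (heU : e.erase (φ p) ⊆ U) :
    ∃ i j : Fin 9, i.val < 6 ∧ j.val < 6 ∧ i ≠ j ∧ e = tr φ (mk3 i j p) := by
  have hc : (e.erase (φ p)).card = 2 := by
    rw [Finset.card_erase_of_mem hpe, h.card3 e he]
  obtain ⟨a, b, hab, heq⟩ := Finset.card_eq_two.1 hc
  rw [heq] at heU
  obtain ⟨i, hi, rfl⟩ := (h.hU a).1 (heU (by simp))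
  obtain ⟨j, hj, rfl⟩ := (h.hU b).1 (heU (by simp))
  refine ⟨i, j, hi, hj, fun h => hab (by rw [h]), ?_⟩
  rw [tr_mk3, ← Finset.insert_erase hpe, heq]
  ext x
  simp
  tauto

theorem card_le_cnt {H φ} (S : Finset (Finset ℕ)) (K : ℕ) (hS : S ⊆ H)
    (hc : ∀ e ∈ S, ∃ m < 512, e = tr φ m ∧ K.testBit m = true) : S.card ≤ cnt H φ K := by
  unfold cnt
  refine le_trans (Finset.card_le_card (t := ((range 512).filter
    (fun m => K.testBit m = true ∧ tr φ m ∈ H)).image (tr φ)) ?_) Finset.card_image_le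
  intro e he
  obtain ⟨m, hm, rfl, hK⟩ := hc e he
  exact Finset.mem_image.2 ⟨m, by simp [hm, hK, hS he], rfl⟩

theorem Ctx.hu_le {H U φ} (h : Ctx H U φ) : hu H U ≤ cnt H φ KU := by
  apply card_le_cnt _ _ (Finset.filter_subset _ _)
  intro e he
  rw [Finset.mem_filter] at he
  exact h.coverU he.1 he.2

/-- every edge has at most one vertex outside `U` -/
def One (H : Finset (Finset ℕ)) (U : Finset ℕ) : Prop :=
  ∀ e ∈ H, ∀ w, w ∉ U → w ∈ e → e.erase w ⊆ U

theorem Ctx.notU {H U φ} (h : Ctx H U φ) (p : Fin 9) (hp : 6 ≤ p.val) : φ p ∉ U := by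
  intro hu
  obtain ⟨i, hi, hip⟩ := (h.hU _).1 hu
  have := h.inj hip
  subst this
  omega

theorem Ctx.cover6 {H U φ} (h : Ctx H U φ) (ho : One H U) {e : Finset ℕ} (he : e ∈ H)
    (hw : φ 6 ∈ e) : ∃ m < 512, e = tr φ m ∧ K6.testBit m = true := by
  obtain ⟨i, j, hi, hj, hij, rfl⟩ := h.coverW he 6 hw (ho e he _ (h.notU 6 (by decide)) hw)
  exact ⟨_, mk3_lt _ _ _, rfl, (bits_K i j hi hj hij).1⟩

theorem Ctx.cover7 {H U φ} (h : Ctx H U φ) (ho : One H U) {e : Finset ℕ} (he : e ∈ H)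
    (hw : φ 7 ∈ e) : ∃ m < 512, e = tr φ m ∧ K7.testBit m = true := by
  obtain ⟨i, j, hi, hj, hij, rfl⟩ := h.coverW he 7 hw (ho e he _ (h.notU 7 (by decide)) hw)
  exact ⟨_, mk3_lt _ _ _, rfl, (bits_K i j hi hj hij).2.1⟩

theorem Ctx.cover8 {H U φ} (h : Ctx H U φ) (ho : One H U) {e : Finset ℕ} (he : e ∈ H)
    (hw : φ 8 ∈ e) : ∃ m < 512, e = tr φ m ∧ K8.testBit m = true := by
  obtain ⟨i, j, hi, hj, hij, rfl⟩ := h.coverW he 8 hw (ho e he _ (h.notU 8 (by decide)) hw)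
  exact ⟨_, mk3_lt _ _ _, rfl, (bits_K i j hi hj hij).2.2⟩

theorem Ctx.dg6 {H U φ} (h : Ctx H U φ) (ho : One H U) : dg H (φ 6) ≤ cnt H φ K6 := by
  apply card_le_cnt _ _ (Finset.filter_subset _ _)
  intro e he
  rw [Finset.mem_filter] at he
  exact h.cover6 ho he.1 he.2

theorem Ctx.dg7 {H U φ} (h : Ctx H U φ) (ho : One H U) : dg H (φ 7) ≤ cnt H φ K7 := by
  apply card_le_cnt _ _ (Finset.filter_subset _ _)
  intro e he
  rw [Finset.mem_filter] at he
  exact h.cover7 ho he.1 he.2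

theorem Ctx.dg8 {H U φ} (h : Ctx H U φ) (ho : One H U) : dg H (φ 8) ≤ cnt H φ K8 := by
  apply card_le_cnt _ _ (Finset.filter_subset _ _)
  intro e he
  rw [Finset.mem_filter] at he
  exact h.cover8 ho he.1 he.2

/-- no edge contains both `φ 6` and `φ 7`. -/
theorem bits_E : ∀ i : Fin 9, i ≠ 6 → i ≠ 7 → poE.testBit (mk3 6 7 i) = true := by decide +kernel

theorem Ctx.lemE {H U φ} (h : Ctx H U φ) (i : Fin 9) (h6 : i ≠ 6) (h7 : i ≠ 7) :
    ({φ 6, φ 7, φ i} : Finset ℕ) ∉ H := by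
  obtain ⟨p, hp, hh⟩ := h.runH [poE] 0 tE 0 0 runE (by simp) (by simp)
  have : p = poE := by simpa using hp
  subst this
  rw [← tr_mk3]
  exact hh _ (bits_E i h6 h7)

theorem bits_good : ∀ m < 512, (KU ||| K6 ||| K7 ||| K8).testBit m = true →
    (pg0.testBit m = true ∨ m.testBit 0 = true ∨ m = 14 ∨ m = 50) ∧
    (pg1.testBit m = true ∨ m.testBit 1 = true ∨ m = 13 ∨ m = 49) := by decide +kernel

theorem bits_good2 : ∀ m < 512, (KU ||| K6 ||| K7).testBit m = true →
    (qg0.testBit m = true ∨ m.testBit 0 = true ∨ m = 14 ∨ m = 50) ∧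
    (qg1.testBit m = true ∨ m.testBit 1 = true ∨ m = 13 ∨ m = 49) := by decide +kernel

theorem bits_sk2 : ∀ m < 512, (KU ||| K6 ||| K7).testBit m = true →
    ps2.testBit m = true ∨ m &&& 51 = m ∨ (m.testBit 2 = true ∧ m &&& 51 ≠ 0) := by
  decide +kernel

theorem bits_sk3 : ∀ m < 512, (KU ||| K6 ||| K7).testBit m = true →
    ps3.testBit m = true ∨ m &&& 51 = m ∨ (m.testBit 3 = true ∧ m &&& 51 ≠ 0) := by
  decide +kernel

theorem bits_sk4 : ∀ m < 512, (KU ||| K6 ||| K7).testBit m = true →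
    ps4.testBit m = true ∨ m &&& 15 = m ∨ (m.testBit 4 = true ∧ m &&& 15 ≠ 0) := by
  decide +kernel

theorem bits_sk5 : ∀ m < 512, (KU ||| K6 ||| K7).testBit m = true →
    ps5.testBit m = true ∨ m &&& 15 = m ∨ (m.testBit 5 = true ∧ m &&& 15 ≠ 0) := by
  decide +kernel

def Good0 (H : Finset (Finset ℕ)) (U : Finset ℕ) (φ : Fin 9 → ℕ) : Prop :=
  ∀ e ∈ H, (e ⊆ U ∨ φ 6 ∈ e ∨ φ 7 ∈ e) → φ 0 ∈ e ∨ e = tr φ 14 ∨ e = tr φ 50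

def Good1 (H : Finset (Finset ℕ)) (U : Finset ℕ) (φ : Fin 9 → ℕ) : Prop :=
  ∀ e ∈ H, (e ⊆ U ∨ φ 6 ∈ e ∨ φ 7 ∈ e) → φ 1 ∈ e ∨ e = tr φ 13 ∨ e = tr φ 49

theorem Ctx.cover {H U φ} (h : Ctx H U φ) (ho : One H U) {e : Finset ℕ} (he : e ∈ H)
    (hw : e ⊆ U ∨ φ 6 ∈ e ∨ φ 7 ∈ e) :
    ∃ m < 512, e = tr φ m ∧ (KU ||| K6 ||| K7).testBit m = true := by
  simp only [Nat.testBit_lor, Bool.or_eq_true]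
  rcases hw with hw | hw | hw
  · obtain ⟨m, hm, h1, h2⟩ := h.coverU he hw
    exact ⟨m, hm, h1, by tauto⟩
  · obtain ⟨m, hm, h1, h2⟩ := h.cover6 ho he hw
    exact ⟨m, hm, h1, by tauto⟩
  · obtain ⟨m, hm, h1, h2⟩ := h.cover7 ho he hw
    exact ⟨m, hm, h1, by tauto⟩

theorem Ctx.lemB {H U φ} (h : Ctx H U φ) (ho : One H U)
    (hs : 15 ≤ dg H (φ 6) + dg H (φ 7) + dg H (φ 8)) : Good0 H U φ ∨ Good1 H U φ := by
  have h6 := h.dg6 ho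
  have h7 := h.dg7 ho
  have h8 := h.dg8 ho
  have hcnt : cnt H φ (K6 ||| K7 ||| K8) = cnt H φ K6 + cnt H φ K7 + cnt H φ K8 := by
    rw [cnt_lor (by decide +kernel), cnt_lor (by decide +kernel)]
  have hcard : ((range 512).filter (fun i => (K6 ||| K7 ||| K8).testBit i = true ∧
    (0 : ℕ).testBit i = false)).card = 45 := by decide +kernel
  obtain ⟨p, hp, hh⟩ := h.runH [pg0, pg1] (K6 ||| K7 ||| K8) tB 0 30 runB (by simp)
    (by omega)
  simp only [List.mem_cons, List.not_mem_nil, or_false] at hp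
  rcases hp with rfl | rfl
  · left
    intro e he hw
    obtain ⟨m, hm, rfl, hK⟩ := h.cover ho he hw
    have := (bits_good m hm (by rw [Nat.testBit_lor, hK]; rfl)).1
    rcases this with h1 | h1 | rfl | rfl
    · exact absurd he (hh m h1)
    · left; exact (mem_tr h.inj 0 m).2 h1
    · right; left; rfl
    · right; right; rfl
  · right
    intro e he hw
    obtain ⟨m, hm, rfl, hK⟩ := h.cover ho he hw
    have := (bits_good m hm (by rw [Nat.testBit_lor, hK]; rfl)).2
    rcases this with h1 | h1 | rfl | rfl
    · exact absurd he (hh m h1)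
    · left; exact (mem_tr h.inj 1 m).2 h1
    · right; left; rfl
    · right; right; rfl

theorem bits_exD : ∀ m < 512, exD.testBit m = true →
    m.testBit 0 = false ∧ (m.testBit 6 = true ∨ m.testBit 7 = true) := by decide +kernel

theorem bits_poD : ∀ m < 512, K8.testBit m = true → poD.testBit m = true ∨ m.testBit 0 = true := by
  decide +kernel

theorem Ctx.lemD {H U φ} (h : Ctx H U φ) (ho : One H U) (hg : Good0 H U φ)
    (hs : 10 ≤ dg H (φ 6) + dg H (φ 7)) : ∀ e ∈ H, φ 8 ∈ e → φ 0 ∈ e := by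
  have h6 := h.dg6 ho
  have h7 := h.dg7 ho
  have hcnt : cnt H φ (K6 ||| K7) = cnt H φ K6 + cnt H φ K7 := cnt_lor (by decide +kernel)
  have hcard : ((range 512).filter (fun i => (K6 ||| K7).testBit i = true ∧
    exD.testBit i = false)).card = 10 := by decide +kernel
  have hex : ∀ i, exD.testBit i = true → i ∈ Fs H φ := by
    intro m hm
    have hlt : m < 512 := bit_lt exD_hi hm
    obtain ⟨hb0, hb⟩ := bits_exD m hlt hm
    refine Finset.mem_filter.2 ⟨Finset.mem_range.2 hlt, fun hmH => ?_⟩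
    have hb' : φ 6 ∈ tr φ m ∨ φ 7 ∈ tr φ m := by
      rw [mem_tr h.inj, mem_tr h.inj]; exact hb
    rcases hg _ hmH (Or.inr hb') with h1 | h1 | h1
    · rw [mem_tr h.inj] at h1
      have h2 : m.testBit 0 = true := h1
      rw [hb0] at h2; cases h2
    · rw [h1, mem_tr h.inj, mem_tr h.inj] at hb'
      revert hb'; decide
    · rw [h1, mem_tr h.inj, mem_tr h.inj] at hb'
      revert hb'; decide
  obtain ⟨p, hp, hh⟩ := h.runH [poD] (K6 ||| K7) tD exD 0 runD hex (by omega)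
  have : p = poD := by simpa using hp
  subst this
  intro e he h8
  obtain ⟨m, hm, rfl, hK⟩ := h.cover8 ho he h8
  rcases bits_poD m hm hK with h1 | h1
  · exact absurd he (hh m h1)
  · exact (mem_tr h.inj 0 m).2 h1

/-- the conclusion of the extremal case -/
def SKc (H : Finset (Finset ℕ)) (U : Finset ℕ) (φ : Fin 9 → ℕ) (c : Fin 9) (A : ℕ) : Prop :=
  (∀ e ∈ H, (e ⊆ U ∨ φ 6 ∈ e ∨ φ 7 ∈ e) → e ⊆ tr φ A ∨ (φ c ∈ e ∧ (e ∩ tr φ A).Nonempty)) ∧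
  hu H U ≤ 14 ∧ dg H (φ 6) ≤ 4 ∧ dg H (φ 7) ≤ 4 ∧
  (dg H (φ 6) = 4 → ({φ c, φ 0, φ 6} : Finset ℕ) ∈ H)

theorem Ctx.mkSK {H U φ} (h : Ctx H U φ) (ho : One H U) (c : Fin 9) (A p : ℕ)
    (hb : ∀ m < 512, (KU ||| K6 ||| K7).testBit m = true →
      p.testBit m = true ∨ m &&& A = m ∨ (m.testBit c = true ∧ m &&& A ≠ 0))
    (hp : ∀ i, p.testBit i = true → tr φ i ∉ H)
    (h1 : ((range 512).filter (fun i => KU.testBit i = true ∧ p.testBit i = false)).card ≤ 14)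
    (h2 : ((range 512).filter (fun i => K6.testBit i = true ∧ p.testBit i = false)).card ≤ 4)
    (h3 : ((range 512).filter (fun i => K7.testBit i = true ∧ p.testBit i = false)).card ≤ 4)
    (h4 : ((range 512).filter (fun i => K6.testBit i = true ∧
      (p ||| 1 <<< mk3 c 0 6).testBit i = false)).card ≤ 3) :
    SKc H U φ c A := by
  refine ⟨?_, le_trans h.hu_le (le_trans (cnt_le hp) h1),
    le_trans (h.dg6 ho) (le_trans (cnt_le hp) h2), le_trans (h.dg7 ho) (le_trans (cnt_le hp) h3), ?_⟩
  · intro e he hw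
    obtain ⟨m, hm, rfl, hK⟩ := h.cover ho he hw
    rcases hb m hm hK with h1 | h1 | h1
    · exact absurd he (hp m h1)
    · left
      rw [← h1, ← tr_inter h.inj]
      exact Finset.inter_subset_right
    · right
      refine ⟨(mem_tr h.inj c m).2 h1.1, ?_⟩
      rw [tr_inter h.inj]
      exact tr_nonempty φ (lt_of_le_of_lt Nat.and_le_left hm) h1.2
  · intro hd
    by_contra hn
    rw [← tr_mk3] at hn
    have := le_trans (h.dg6 ho) (le_trans (cnt_le (p := p ||| 1 <<< mk3 c 0 6) (by
      intro i hi
      rw [Nat.testBit_lor, Bool.or_eq_true, testBit_one_shl] at hi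
      rcases hi with hi | rfl
      · exact hp i hi
      · exact hn)) h4)
    omega

theorem Ctx.lemC {H U φ} (h : Ctx H U φ) (ho : One H U)
    (hs : 22 ≤ hu H U + dg H (φ 6) + dg H (φ 7)) :
    (Good0 H U φ ∧ 10 ≤ dg H (φ 6) + dg H (φ 7)) ∨
    (Good1 H U φ ∧ 10 ≤ dg H (φ 6) + dg H (φ 7)) ∨
    ((SKc H U φ 2 51 ∨ SKc H U φ 3 51) ∨ (SKc H U φ 4 15 ∨ SKc H U φ 5 15)) := by
  have h6 := h.dg6 ho
  have h7 := h.dg7 ho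
  have h8 := h.hu_le
  have hcnt : cnt H φ (KU ||| K6 ||| K7) = cnt H φ KU + cnt H φ K6 + cnt H φ K7 := by
    rw [cnt_lor (by decide +kernel), cnt_lor (by decide +kernel)]
  have hcard : ((range 512).filter (fun i => (KU ||| K6 ||| K7).testBit i = true ∧
    (0 : ℕ).testBit i = false)).card = 50 := by decide +kernel
  obtain ⟨p, hp, hh⟩ := h.runH [qg0, qg1, ps2, ps3, ps4, ps5] (KU ||| K6 ||| K7) tC 0 28 runC
    (by simp) (by omega)
  simp only [List.mem_cons, List.not_mem_nil, or_false] at hp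
  rcases hp with rfl | rfl | rfl | rfl | rfl | rfl
  · left
    refine ⟨?_, ?_⟩
    · intro e he hw
      obtain ⟨m, hm, rfl, hK⟩ := h.cover ho he hw
      rcases (bits_good2 m hm hK).1 with h1 | h1 | rfl | rfl
      · exact absurd he (hh m h1)
      · left; exact (mem_tr h.inj 0 m).2 h1
      · right; left; rfl
      · right; right; rfl
    · have h1 := cnt_le (K := KU) hh
      have h2 : ((range 512).filter
        (fun i => KU.testBit i = true ∧ qg0.testBit i = false)).card = 12 := by decide +kernel
      omega
  · right; left
    refine ⟨?_, ?_⟩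
    · intro e he hw
      obtain ⟨m, hm, rfl, hK⟩ := h.cover ho he hw
      rcases (bits_good2 m hm hK).2 with h1 | h1 | rfl | rfl
      · exact absurd he (hh m h1)
      · left; exact (mem_tr h.inj 1 m).2 h1
      · right; left; rfl
      · right; right; rfl
    · have h1 := cnt_le (K := KU) hh
      have h2 : ((range 512).filter
        (fun i => KU.testBit i = true ∧ qg1.testBit i = false)).card = 12 := by decide +kernel
      omega
  · right; right; left; left
    exact h.mkSK ho 2 51 ps2 bits_sk2 hh (by decide +kernel)
      (by decide +kernel) (by decide +kernel) (by decide +kernel)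
  · right; right; left; right
    exact h.mkSK ho 3 51 ps3 bits_sk3 hh (by decide +kernel)
      (by decide +kernel) (by decide +kernel) (by decide +kernel)
  · right; right; right; left
    exact h.mkSK ho 4 15 ps4 bits_sk4 hh (by decide +kernel)
      (by decide +kernel) (by decide +kernel) (by decide +kernel)
  · right; right; right; right
    exact h.mkSK ho 5 15 ps5 bits_sk5 hh (by decide +kernel)
      (by decide +kernel) (by decide +kernel) (by decide +kernel)

/-! ### The counting argument -/

structure Base (H : Finset (Finset ℕ)) (U : Finset ℕ) (x1 x2 y1 y2 z1 z2 : ℕ) : Prop where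
  nd : [x1, x2, y1, y2, z1, z2].Nodup
  hU : U = {x1, x2, y1, y2, z1, z2}
  free : P4Free H
  m3 : ¬HasM3 H
  card3 : ∀ e ∈ H, e.card = 3
  e1 : ({x1, y1, y2} : Finset ℕ) ∈ H
  e2 : ({x2, y1, y2} : Finset ℕ) ∈ H
  e3 : ({x1, z1, z2} : Finset ℕ) ∈ H
  e4 : ({x2, z1, z2} : Finset ℕ) ∈ H

theorem Base.swap {H U x1 x2 y1 y2 z1 z2} (b : Base H U x1 x2 y1 y2 z1 z2) :
    Base H U x2 x1 y1 y2 z1 z2 := by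
  refine ⟨?_, ?_, b.free, b.m3, b.card3, b.e2, b.e1, b.e4, b.e3⟩
  · have := b.nd
    simp at this ⊢
    grind
  · rw [b.hU, Finset.insert_comm]

def ph (x1 x2 y1 y2 z1 z2 p q r : ℕ) : Fin 9 → ℕ := ![x1, x2, y1, y2, z1, z2, p, q, r]

theorem tr13 (x1 x2 y1 y2 z1 z2 p q r : ℕ) :
    tr (ph x1 x2 y1 y2 z1 z2 p q r) 13 = {x1, y1, y2} := tr_mk3 _ 0 2 3
theorem tr14 (x1 x2 y1 y2 z1 z2 p q r : ℕ) :
    tr (ph x1 x2 y1 y2 z1 z2 p q r) 14 = {x2, y1, y2} := tr_mk3 _ 1 2 3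
theorem tr49 (x1 x2 y1 y2 z1 z2 p q r : ℕ) :
    tr (ph x1 x2 y1 y2 z1 z2 p q r) 49 = {x1, z1, z2} := tr_mk3 _ 0 4 5
theorem tr50 (x1 x2 y1 y2 z1 z2 p q r : ℕ) :
    tr (ph x1 x2 y1 y2 z1 z2 p q r) 50 = {x2, z1, z2} := tr_mk3 _ 1 4 5
theorem tr51 (x1 x2 y1 y2 z1 z2 p q r : ℕ) :
    tr (ph x1 x2 y1 y2 z1 z2 p q r) 51 = {x1, x2, z1, z2} := by
  have : (univ.filter (fun l : Fin 9 => (51 : ℕ).testBit l = true)) = {0, 1, 4, 5} := by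
    decide
  unfold tr
  rw [this]
  simp [Finset.image_insert, ph]
theorem tr15 (x1 x2 y1 y2 z1 z2 p q r : ℕ) :
    tr (ph x1 x2 y1 y2 z1 z2 p q r) 15 = {x1, x2, y1, y2} := by
  have : (univ.filter (fun l : Fin 9 => (15 : ℕ).testBit l = true)) = {0, 1, 2, 3} := by
    decide
  unfold tr
  rw [this]
  simp [Finset.image_insert, ph]

theorem Base.ctx {H U x1 x2 y1 y2 z1 z2} (b : Base H U x1 x2 y1 y2 z1 z2) {p q r : ℕ}
    (hp : p ∉ U) (hq : q ∉ U) (hr : r ∉ U) (hpq : p ≠ q) (hpr : p ≠ r) (hqr : q ≠ r) :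
    Ctx H U (ph x1 x2 y1 y2 z1 z2 p q r) := by
  refine ⟨?_, ?_, b.free, b.m3, b.card3, ?_, ?_, ?_, ?_⟩
  · rw [← List.nodup_ofFn]
    have hl : List.ofFn (ph x1 x2 y1 y2 z1 z2 p q r) =
      [x1, x2, y1, y2, z1, z2] ++ [p, q, r] := rfl
    rw [hl, List.nodup_append]
    refine ⟨b.nd, by simp [hpq, hpr, hqr], ?_⟩
    intro u hu v hv huv
    have huU : u ∈ U := by rw [b.hU]; simpa using hu
    subst huv
    simp only [List.mem_cons, List.not_mem_nil, or_false] at hv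
    rcases hv with rfl | rfl | rfl
    · exact hp huU
    · exact hq huU
    · exact hr huU
  · intro u
    rw [b.hU]
    constructor
    · intro h
      simp only [Finset.mem_insert, Finset.mem_singleton] at h
      rcases h with rfl | rfl | rfl | rfl | rfl | rfl
      · exact ⟨0, by decide, rfl⟩
      · exact ⟨1, by decide, rfl⟩
      · exact ⟨2, by decide, rfl⟩
      · exact ⟨3, by decide, rfl⟩
      · exact ⟨4, by decide, rfl⟩
      · exact ⟨5, by decide, rfl⟩
    · rintro ⟨i, hi, rfl⟩
      fin_cases i <;> simp [ph] at hi ⊢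
  · rw [tr13]; exact b.e1
  · rw [tr14]; exact b.e2
  · rw [tr49]; exact b.e3
  · rw [tr50]; exact b.e4

theorem Base.one {H U x1 x2 y1 y2 z1 z2} (b : Base H U x1 x2 y1 y2 z1 z2) : One H U := by
  intro e he w hw hwe v hv
  by_contra hvU
  obtain ⟨hvw, hve⟩ := Finset.mem_erase.1 hv
  have hc : ((e.erase w).erase v).card = 1 := by
    rw [Finset.card_erase_of_mem hv, Finset.card_erase_of_mem hwe, b.card3 e he]
  obtain ⟨u, hu⟩ := Finset.card_eq_one.1 hc
  have heq : e = {w, v, u} := by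
    rw [← Finset.insert_erase hwe, ← Finset.insert_erase hv, hu]
  have hu' : u ∈ (e.erase w).erase v := by rw [hu]; simp
  have huv : u ≠ v := (Finset.mem_erase.1 hu').1
  have huw : u ≠ w := (Finset.mem_erase.1 (Finset.mem_erase.1 hu').2).1
  by_cases huU : u ∈ U
  · obtain ⟨r, hr⟩ := Infinite.exists_notMem_finset (U ∪ {w, v})
    simp only [Finset.mem_union, Finset.mem_insert, Finset.mem_singleton, not_or] at hr
    have c := b.ctx hw hvU hr.1 hvw.symm (Ne.symm hr.2.1) (Ne.symm hr.2.2)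
    obtain ⟨i, hi, hiu⟩ := (c.hU u).1 huU
    have := c.lemE i (fun h => by rw [h] at hi; revert hi; decide)
      (fun h => by rw [h] at hi; revert hi; decide)
    rw [hiu] at this
    exact this (by rw [heq] at he; exact he)
  · have c := b.ctx hw hvU huU hvw.symm huw.symm huv.symm
    have := c.lemE 8 (by decide) (by decide)
    exact this (by rw [heq] at he; exact he)

/-- the edges near `p, q` are compatible with the star at `x1` -/
def GP (H : Finset (Finset ℕ)) (U : Finset ℕ) (x1 x2 y1 y2 z1 z2 p q : ℕ) : Prop :=
  ∀ e ∈ H, (e ⊆ U ∨ p ∈ e ∨ q ∈ e) → x1 ∈ e ∨ e = {x2, y1, y2} ∨ e = {x2, z1, z2}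

theorem good0_iff {H U x1 x2 y1 y2 z1 z2 p q r} :
    Good0 H U (ph x1 x2 y1 y2 z1 z2 p q r) ↔ GP H U x1 x2 y1 y2 z1 z2 p q := by
  unfold Good0 GP
  rw [tr14, tr50]
  rfl

theorem good1_iff {H U x1 x2 y1 y2 z1 z2 p q r} :
    Good1 H U (ph x1 x2 y1 y2 z1 z2 p q r) ↔ GP H U x2 x1 y1 y2 z1 z2 p q := by
  unfold Good1 GP
  rw [tr13, tr49]
  rfl

theorem Base.lemX {H U V x1 x2 y1 y2 z1 z2} (b : Base H U x1 x2 y1 y2 z1 z2)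
    (hH : ThreeGraphOn V H) {p q : ℕ} (hp : p ∉ U) (hq : q ∉ U) (hpq : p ≠ q)
    (hg : GP H U x1 x2 y1 y2 z1 z2 p q) (hs : 10 ≤ dg H p + dg H q) : SubSP V H := by
  have hall : ∀ e ∈ H, x1 ∈ e ∨ e = {x2, y1, y2} ∨ e = {x2, z1, z2} := by
    intro e he
    by_cases h : e ⊆ U ∨ p ∈ e ∨ q ∈ e
    · exact hg e he h
    · push Not at h
      obtain ⟨h1, h2, h3⟩ := h
      obtain ⟨w, hwe, hwU⟩ := Finset.not_subset.1 h1
      have c := b.ctx hp hq hwU hpq (fun h => h2 (h ▸ hwe)) (fun h => h3 (h ▸ hwe))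
      exact Or.inl (c.lemD b.one (good0_iff.2 hg) hs e he hwe)
  have hnd := b.nd
  simp at hnd
  have hUV : ∀ e ∈ H, e ⊆ V := fun e he => (hH e he).1
  refine ⟨_, ⟨x1, hUV _ b.e1 (by simp), {x2, y1, y2}, {x2, z1, z2}, hUV _ b.e2, hUV _ b.e4,
    b.card3 _ b.e2, b.card3 _ b.e4, ?_, ?_, rfl⟩, ?_⟩
  · have : ({x2, y1, y2} ∩ {x2, z1, z2} : Finset ℕ) = {x2} := by
      ext v
      simp
      grind
    rw [this]; rfl
  · simp
    grind
  · intro e he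
    rcases hall e he with h | h | h
    · refine Finset.mem_union_right _ (Finset.mem_filter.2
        ⟨Finset.mem_powersetCard.2 (hH e he), h, ?_⟩)
      have h2 : ∃ v ∈ e, v ≠ x1 ∧ v ∈ U := by
        by_cases heU : e ⊆ U
        · have : 0 < (e.erase x1).card := by
            rw [Finset.card_erase_of_mem h, b.card3 e he]; norm_num
          obtain ⟨v, hv⟩ := Finset.card_pos.1 this
          obtain ⟨h3, h4⟩ := Finset.mem_erase.1 hv
          exact ⟨v, h4, h3, heU h4⟩
        · obtain ⟨w, hwe, hwU⟩ := Finset.not_subset.1 heU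
          have ho := b.one e he w hwU hwe
          have hx : x1 ≠ w := by
            rintro rfl
            exact hwU (by rw [b.hU]; simp)
          have : 0 < ((e.erase w).erase x1).card := by
            rw [Finset.card_erase_of_mem (Finset.mem_erase.2 ⟨hx, h⟩),
              Finset.card_erase_of_mem hwe, b.card3 e he]; norm_num
          obtain ⟨v, hv⟩ := Finset.card_pos.1 this
          obtain ⟨h3, h4⟩ := Finset.mem_erase.1 hv
          exact ⟨v, (Finset.mem_erase.1 h4).2, h3, ho h4⟩
      obtain ⟨v, hv, hvx, hvU⟩ := h2
      refine ⟨v, Finset.mem_inter.2 ⟨hv, ?_⟩⟩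
      rw [b.hU] at hvU
      simp at hvU ⊢
      tauto
    · exact Finset.mem_union_left _ (by simp [h])
    · exact Finset.mem_union_left _ (by simp [h])

/-- centre and core of the possible extremal configurations -/
def QQ (x1 x2 y1 y2 z1 z2 c : ℕ) (A : Finset ℕ) : Prop :=
  ((c = y1 ∨ c = y2) ∧ A = {x1, x2, z1, z2}) ∨ ((c = z1 ∨ c = z2) ∧ A = {x1, x2, y1, y2})

def SKp (H : Finset (Finset ℕ)) (U : Finset ℕ) (x1 p q c : ℕ) (A : Finset ℕ) : Prop :=
  (∀ e ∈ H, (e ⊆ U ∨ p ∈ e ∨ q ∈ e) → e ⊆ A ∨ (c ∈ e ∧ (e ∩ A).Nonempty)) ∧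
  hu H U ≤ 14 ∧ dg H p ≤ 4 ∧ dg H q ≤ 4 ∧
  (dg H p = 4 → ({c, x1, p} : Finset ℕ) ∈ H)

theorem Base.lemC {H U x1 x2 y1 y2 z1 z2} (b : Base H U x1 x2 y1 y2 z1 z2)
    {p q : ℕ} (hp : p ∉ U) (hq : q ∉ U) (hpq : p ≠ q) (hs : 22 ≤ hu H U + dg H p + dg H q) :
    (GP H U x1 x2 y1 y2 z1 z2 p q ∧ 10 ≤ dg H p + dg H q) ∨
    (GP H U x2 x1 y1 y2 z1 z2 p q ∧ 10 ≤ dg H p + dg H q) ∨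
    ∃ c A, QQ x1 x2 y1 y2 z1 z2 c A ∧ SKp H U x1 p q c A := by
  obtain ⟨r, hr⟩ := Infinite.exists_notMem_finset (U ∪ {p, q})
  simp only [Finset.mem_union, Finset.mem_insert, Finset.mem_singleton, not_or] at hr
  have c := b.ctx hp hq hr.1 hpq (Ne.symm hr.2.1) (Ne.symm hr.2.2)
  rcases c.lemC b.one hs with h | h | h
  · exact Or.inl ⟨good0_iff.1 h.1, h.2⟩
  · exact Or.inr (Or.inl ⟨good1_iff.1 h.1, h.2⟩)
  · right; right
    unfold SKc at h
    rw [tr51, tr15] at h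
    rcases h with (h | h) | (h | h)
    · exact ⟨y1, _, Or.inl ⟨Or.inl rfl, rfl⟩, h⟩
    · exact ⟨y2, _, Or.inl ⟨Or.inr rfl, rfl⟩, h⟩
    · exact ⟨z1, _, Or.inr ⟨Or.inl rfl, rfl⟩, h⟩
    · exact ⟨z2, _, Or.inr ⟨Or.inr rfl, rfl⟩, h⟩

theorem Base.qq {H U x1 x2 y1 y2 z1 z2} (b : Base H U x1 x2 y1 y2 z1 z2) {c A}
    (h : QQ x1 x2 y1 y2 z1 z2 c A) :
    A ⊆ U ∧ c ∈ U ∧ c ∉ A ∧ A.card = 4 ∧ c ≠ x1 := by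
  have hnd := b.nd
  simp at hnd
  rw [b.hU]
  rcases h with ⟨h, rfl⟩ | ⟨h, rfl⟩
  · refine ⟨?_, ?_, ?_, ?_, ?_⟩
    · intro v
      simp
      tauto
    · simp; tauto
    · simp; grind
    · have : ({x1, x2, z1, z2} : Finset ℕ) = [x1, x2, z1, z2].toFinset := by simp
      rw [this, List.toFinset_card_of_nodup]
      · rfl
      · simp; grind
    · grind
  · refine ⟨?_, ?_, ?_, ?_, ?_⟩
    · intro v
      simp
      tauto
    · simp; tauto
    · simp; grind
    · have : ({x1, x2, y1, y2} : Finset ℕ) = [x1, x2, y1, y2].toFinset := by simp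
      rw [this, List.toFinset_card_of_nodup]
      · rfl
      · simp; grind
    · grind

theorem Base.qq_eq {H U x1 x2 y1 y2 z1 z2} (b : Base H U x1 x2 y1 y2 z1 z2) {c A A'}
    (h : QQ x1 x2 y1 y2 z1 z2 c A) (h' : QQ x1 x2 y1 y2 z1 z2 c A') : A = A' := by
  have hnd := b.nd
  simp at hnd
  rcases h with ⟨h, rfl⟩ | ⟨h, rfl⟩ <;> rcases h' with ⟨h', rfl⟩ | ⟨h', rfl⟩
  · rfl
  · grind
  · grind
  · rfl

theorem card_mem (S : Finset ℕ) (v : ℕ) (hv : v ∈ S) :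
    ((S.powersetCard 3).filter (fun t => v ∈ t)).card = (S.card - 1).choose 2 := by
  have h1 := Finset.card_filter_add_card_filter_not (s := S.powersetCard 3) (fun t => v ∈ t)
  have h2 : (S.powersetCard 3).filter (fun t => ¬ v ∈ t) = (S.erase v).powersetCard 3 := by
    ext t
    simp only [Finset.mem_filter, Finset.mem_powersetCard, Finset.subset_erase]
    tauto
  rw [h2, Finset.card_powersetCard, Finset.card_powersetCard, Finset.card_erase_of_mem hv] at h1
  obtain ⟨m, hm⟩ : ∃ m, S.card = m + 1 :=
    ⟨S.card - 1, by have := Finset.card_pos.2 ⟨v, hv⟩; omega⟩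
  rw [hm] at h1 ⊢
  have := Nat.choose_succ_succ' m 2
  simp only [Nat.add_sub_cancel] at *
  norm_num at this
  omega

theorem card_SK (V A : Finset ℕ) (v : ℕ) (hv : v ∈ V) (hA : A ⊆ V) (hA4 : A.card = 4)
    (hvA : v ∉ A) : (A.powersetCard 3 ∪
      (V.powersetCard 3).filter (fun t => v ∈ t ∧ (t ∩ A).Nonempty)).card = 4 * V.card - 10 := by
  rw [Finset.card_union_of_disjoint, Finset.card_powersetCard, hA4]
  · have h1 := Finset.card_filter_add_card_filter_not
      (s := (V.powersetCard 3).filter (fun t => v ∈ t)) (fun t => (t ∩ A).Nonempty)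
    rw [Finset.filter_filter, Finset.filter_filter, card_mem V v hv] at h1
    have h2 : (V.powersetCard 3).filter (fun t => v ∈ t ∧ ¬ (t ∩ A).Nonempty) =
        ((V \ A).powersetCard 3).filter (fun t => v ∈ t) := by
      ext t
      simp only [Finset.mem_filter, Finset.mem_powersetCard, Finset.subset_sdiff,
        Finset.not_nonempty_iff_eq_empty, Finset.disjoint_iff_inter_eq_empty]
      tauto
    rw [h2, card_mem _ v (Finset.mem_sdiff.2 ⟨hv, hvA⟩), Finset.card_sdiff_of_subset hA, hA4] at h1
    have h5 : 5 ≤ V.card := by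
      have := Finset.card_le_card (Finset.insert_subset hv hA)
      rw [Finset.card_insert_of_notMem hvA, hA4] at this
      exact this
    obtain ⟨m, hm⟩ := Nat.exists_eq_add_of_le h5
    rw [hm] at h1 ⊢
    have e1 : 5 + m - 1 = m + 1 + 1 + 1 + 1 := by omega
    have e2 : 5 + m - 4 - 1 = m := by omega
    rw [e1, e2] at h1
    simp only [Nat.choose_succ_succ' _ 1, Nat.choose_one_right, Nat.reduceAdd] at h1
    have : Nat.choose 4 3 = 4 := by decide
    omega
  · rw [Finset.disjoint_left]
    intro t h1 h2
    exact hvA ((Finset.mem_powersetCard.1 h1).1 (Finset.mem_filter.1 h2).2.1)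

theorem Base.main {H U V x1 x2 y1 y2 z1 z2} (b : Base H U x1 x2 y1 y2 z1 z2)
    (hH : ThreeGraphOn V H) (hn : 9 ≤ V.card) (hsp : ¬SubSP V H) :
    H.card ≤ 4 * V.card - 10 ∧ (H.card = 4 * V.card - 10 → IsSKOn V H) := by
  have hUV : U ⊆ V := by
    have h1 := (hH _ b.e1).1
    have h2 := (hH _ b.e4).1
    rw [b.hU]
    intro v hv
    simp only [Finset.mem_insert, Finset.mem_singleton] at hv
    by_cases h : v = x1 ∨ v = y1 ∨ v = y2
    · exact h1 (by simpa using h)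
    · exact h2 (by simp; tauto)
  have hU6 : U.card = 6 := by
    have : U = [x1, x2, y1, y2, z1, z2].toFinset := by rw [b.hU]; simp
    rw [this, List.toFinset_card_of_nodup b.nd]
    rfl
  have hW : (V \ U).card = V.card - 6 := by rw [Finset.card_sdiff_of_subset hUV, hU6]
  have hcov : H.card ≤ hu H U + ∑ w ∈ V \ U, dg H w := by
    have : H ⊆ H.filter (fun e => e ⊆ U) ∪ (V \ U).biUnion (fun w => H.filter (fun e => w ∈ e)) := by
      intro e he
      by_cases h : e ⊆ U
      · exact Finset.mem_union_left _ (Finset.mem_filter.2 ⟨he, h⟩)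
      · obtain ⟨w, hwe, hwU⟩ := Finset.not_subset.1 h
        exact Finset.mem_union_right _ (Finset.mem_biUnion.2
          ⟨w, Finset.mem_sdiff.2 ⟨(hH e he).1 hwe, hwU⟩, Finset.mem_filter.2 ⟨he, hwe⟩⟩)
    refine le_trans (Finset.card_le_card this) (le_trans (Finset.card_union_le _ _) ?_)
    exact Nat.add_le_add_left Finset.card_biUnion_le _
  have hX : ∀ {p q : ℕ}, p ∉ U → q ∉ U → p ≠ q → 10 ≤ dg H p + dg H q →
      ¬ GP H U x1 x2 y1 y2 z1 z2 p q ∧ ¬ GP H U x2 x1 y1 y2 z1 z2 p q := by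
    intro p q hp hq hpq hs
    exact ⟨fun hg => hsp (b.lemX hH hp hq hpq hg hs), fun hg => hsp (b.swap.lemX hH hp hq hpq hg hs)⟩
  obtain ⟨w1, hw1, hmax1⟩ := Finset.exists_max_image (V \ U) (dg H)
    (Finset.card_pos.1 (by omega))
  have hW1 : ((V \ U).erase w1).card = V.card - 7 := by
    rw [Finset.card_erase_of_mem hw1, hW]; omega
  obtain ⟨w2, hw2, hmax2⟩ := Finset.exists_max_image ((V \ U).erase w1) (dg H)
    (Finset.card_pos.1 (by omega))
  have hW2 : (((V \ U).erase w1).erase w2).card = V.card - 8 := by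
    rw [Finset.card_erase_of_mem hw2, hW1]; omega
  have hw1U : w1 ∉ U := (Finset.mem_sdiff.1 hw1).2
  have hw21 : w2 ≠ w1 := (Finset.mem_erase.1 hw2).1
  have hw2W := (Finset.mem_erase.1 hw2).2
  have hw2U : w2 ∉ U := (Finset.mem_sdiff.1 hw2W).2
  by_cases hbig : 22 ≤ hu H U + dg H w1 + dg H w2
  · rcases b.lemC hw1U hw2U hw21.symm hbig with h | h | ⟨c, A, hQ, hSK⟩
    · exact absurd h.1 (hX hw1U hw2U hw21.symm h.2).1
    · exact absurd h.1 (hX hw1U hw2U hw21.symm h.2).2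
    · obtain ⟨hed, hhu, hd1, hd2, hin⟩ := hSK
      have hle : ∀ w ∈ V \ U, dg H w ≤ 4 := fun w hw => le_trans (hmax1 w hw) hd1
      have hsum : ∑ w ∈ V \ U, dg H w ≤ _ := Finset.sum_le_card_nsmul _ _ _ hle
      rw [hW, smul_eq_mul] at hsum
      refine ⟨by omega, fun heq => ?_⟩
      have hall : ∀ w ∈ V \ U, dg H w = 4 := by
        by_contra hcon
        push Not at hcon
        obtain ⟨w, hw, hne⟩ := hcon
        have := Finset.sum_lt_sum hle ⟨w, hw, lt_of_le_of_ne (hle w hw) hne⟩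
        rw [Finset.sum_const, hW, smul_eq_mul] at this
        omega
      have hhu14 : hu H U = 14 := by omega
      have hmem := hin (hall w1 hw1)
      obtain ⟨hAU, hcU, hcA, hA4, hcx⟩ := b.qq hQ
      have hgen : ∀ e ∈ H, e ⊆ A ∨ (c ∈ e ∧ (e ∩ A).Nonempty) := by
        intro e he
        by_cases heU : e ⊆ U ∨ w1 ∈ e
        · exact hed e he (by tauto)
        · push Not at heU
          obtain ⟨w, hwe, hwU⟩ := Finset.not_subset.1 heU.1
          have hww : w1 ≠ w := fun h => heU.2 (h ▸ hwe)
          have hwW : w ∈ V \ U := Finset.mem_sdiff.2 ⟨(hH e he).1 hwe, hwU⟩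
          have h1 := hall w1 hw1
          have h2 := hall w hwW
          rcases b.lemC hw1U hwU hww (by omega) with h | h | ⟨c', A', hQ', hSK'⟩
          · omega
          · omega
          · obtain ⟨hAU', hcU', hcA', hA4', hcx'⟩ := b.qq hQ'
            have hcc : c' = c := by
              rcases hSK'.1 _ hmem (by simp) with h | h
              · exact absurd (hAU' (h (by simp))) hw1U
              · have h3 := h.1
                simp only [Finset.mem_insert, Finset.mem_singleton] at h3
                rcases h3 with h3 | h3 | h3
                · exact h3
                · exact absurd h3 hcx'
                · exact absurd (h3 ▸ hcU') hw1U
            subst hcc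
            have hAA := b.qq_eq hQ' hQ
            subst hAA
            exact hSK'.1 e he (by tauto)
      refine ⟨c, hUV hcU, A, hAU.trans hUV, hA4, hcA, ?_⟩
      apply Finset.eq_of_subset_of_card_le
      · intro e he
        rcases hgen e he with h | h
        · exact Finset.mem_union_left _ (Finset.mem_powersetCard.2 ⟨h, b.card3 e he⟩)
        · exact Finset.mem_union_right _ (Finset.mem_filter.2
            ⟨Finset.mem_powersetCard.2 (hH e he), h⟩)
      · rw [card_SK V A c (hUV hcU) (hAU.trans hUV) hA4 hcA, heq]
  · have hle : ∀ w ∈ ((V \ U).erase w1).erase w2, dg H w ≤ 4 := by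
      intro w hw
      by_contra h5
      obtain ⟨hne2, hw'⟩ := Finset.mem_erase.1 hw
      obtain ⟨hne1, hw''⟩ := Finset.mem_erase.1 hw'
      have hwU := (Finset.mem_sdiff.1 hw'').2
      have h1 := hmax1 w hw''
      have h2 := hmax2 w hw'
      have c := b.ctx hw1U hw2U hwU hw21.symm hne1.symm hne2.symm
      have hx := hX hw1U hw2U hw21.symm (by omega)
      have hs : 15 ≤ dg H w1 + dg H w2 + dg H w := by omega
      rcases c.lemB b.one hs with h | h
      · exact hx.1 (good0_iff.1 h)
      · exact hx.2 (good1_iff.1 h)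
    have hsum : ∑ w ∈ ((V \ U).erase w1).erase w2, dg H w ≤ _ :=
      Finset.sum_le_card_nsmul _ _ _ hle
    rw [hW2, smul_eq_mul] at hsum
    rw [← Finset.add_sum_erase _ _ hw1, ← Finset.add_sum_erase _ _ hw2] at hcov
    constructor
    · omega
    · intro; omega

theorem final (n : ℕ) (hn : 9 ≤ n)
    (V : Finset ℕ) (H : Finset (Finset ℕ)) (hV : V.card = n)
    (hH : ThreeGraphOn V H) (hfree : P4Free H)
    (hM3 : ¬HasM3 H) (hC4 : HasC4 H) (hnsp : ¬SubSP V H) :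
    H.card ≤ 4 * n - 10 ∧ (H.card = 4 * n - 10 ↔ IsSKOn V H) := by
  subst hV
  obtain ⟨x1, x2, y1, y2, z1, z2, h6, e1, e2, e3, e4⟩ := hC4
  have hnd : [x1, x2, y1, y2, z1, z2].Nodup := by
    have : ({x1, x2, y1, y2, z1, z2} : Finset ℕ) = [x1, x2, y1, y2, z1, z2].toFinset := by simp
    rw [this] at h6
    exact Multiset.toFinset_card_eq_card_iff_nodup.1 h6
  have r1 : ({y1, y2, x2} : Finset ℕ) = {x2, y1, y2} := by
    ext v; simp; tauto
  have r2 : ({z1, z2, x1} : Finset ℕ) = {x1, z1, z2} := by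
    ext v; simp; tauto
  have b : Base H {x1, x2, y1, y2, z1, z2} x1 x2 y1 y2 z1 z2 :=
    ⟨hnd, rfl, hfree, hM3, fun e he => (hH e he).2, e1, r1 ▸ e2, r2 ▸ e4, e3⟩
  obtain ⟨h1, h2⟩ := b.main hH hn hnsp
  refine ⟨h1, h2, ?_⟩
  rintro ⟨v, hv, A, hA, hA4, hvA, rfl⟩
  exact card_SK V A v hv hA hA4 hvA


end C42

/-- Lemma 3.5: a connected `𝒫₄`-free 3-graph on `n ≥ 9` vertices with no three
pairwise disjoint edges, containing a minimal 4-cycle, and not a sub-3-graph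
of `SPₙ`, has at most `4n - 10` edges, with equality iff `H ≅ SKₙ`. -/
theorem lemma_c42 (n : ℕ) (hn : 9 ≤ n)
    (V : Finset ℕ) (H : Finset (Finset ℕ)) (hV : V.card = n)
    (hH : ThreeGraphOn V H) (hconn : ConnectedHG V H) (hfree : P4Free H)
    (hM3 : ¬HasM3 H) (hC4 : HasC4 H) (hnsp : ¬SubSP V H) :
    H.card ≤ 4 * n - 10 ∧ (H.card = 4 * n - 10 ↔ IsSKOn V H) := by
  exact C42.final n hn V H hV hH hfree hM3 hC4 hnsp
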